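/- arXiv:math/0602060 — 6 statements merged into one kernel-verified Lean document; each statement's English description precedes it below -/
import Mathlib

section
/- Let α ∈ K with α ≠ 0 and v_K(α) odd. Then v_K(σ(α) + α) = v_K(α) + b and v_K(σ(α) − α) = v_K(α) + b. -/
/-- Let `k` be a finite extension of `ℚ₂` with normalized valuation `v_k`
and absolute ramification index `e = v_k 2`, and let `K/k` be a totally ramified quadratic
Galois extension with nontrivial automorphism `σ` and normalized valuation `v` (so `v = 2 v_k`
on `k`, and `v 2 = 2 e`).  Let `b` be the ramification number of `K/k`, i.e.
`v (σ π - π) = b + 1` for every uniformizer `π` of `K`; assume `b` is odd and `b < 2 e`.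
Then for every `α ∈ K` with `α ≠ 0` and `v α` odd, we have
`v (σ α + α) = v α + b` and `v (σ α - α) = v α + b`. -/
theorem stmt_0
    (K : Type*) [Field K] (σ : K ≃+* K) (v : K → ℤ) (e b : ℤ)
    -- `v` is an additive valuation on `K`, surjective onto `ℤ`
    (hv_mul : ∀ x y : K, x ≠ 0 → y ≠ 0 → v (x * y) = v x + v y)
    (hv_add : ∀ x y : K, x ≠ 0 → y ≠ 0 → x + y ≠ 0 → min (v x) (v y) ≤ v (x + y))
    (hv_surj : ∀ n : ℤ, ∃ x : K, x ≠ 0 ∧ v x = n)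
    -- `K` is complete with respect to `v` (it is a finite extension of `ℚ₂`)
    (hv_complete : ∀ f : ℕ → K,
      (∀ m : ℕ, f (m + 1) - f m = 0 ∨ (m : ℤ) ≤ v (f (m + 1) - f m)) →
      ∃ x : K, ∀ m : ℕ, x - f m = 0 ∨ (m : ℤ) ≤ v (x - f m))
    -- `σ` is the nontrivial automorphism of the quadratic extension `K/k`,
    -- where `k` is its fixed field; `σ` preserves the valuation
    (hσ_invol : ∀ x : K, σ (σ x) = x) (hσ_ne : ∃ x : K, σ x ≠ x)
    (hσ_val : ∀ x : K, x ≠ 0 → v (σ x) = v x)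
    -- `K/k` is totally ramified:  `v (kˣ) = 2ℤ`
    (hk_even : ∀ x : K, x ≠ 0 → σ x = x → 2 ∣ v x)
    (hk_onto : ∀ m : ℤ, ∃ x : K, x ≠ 0 ∧ σ x = x ∧ v x = 2 * m)
    -- the absolute ramification index of `k` is `e`, so `v 2 = 2 e`
    (hv_two : v (2 : K) = 2 * e)
    -- `b` is the ramification number of `K/k`; it is odd and `b < 2 e`
    (hb_odd : Odd b) (hb_lt : b < 2 * e)
    (hb_ram : ∀ π : K, π ≠ 0 → v π = 1 → σ π - π ≠ 0 ∧ v (σ π - π) = b + 1) :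
    ∀ α : K, α ≠ 0 → Odd (v α) →
      (σ α + α ≠ 0 ∧ v (σ α + α) = v α + b) ∧
      (σ α - α ≠ 0 ∧ v (σ α - α) = v α + b) := by
  intro α hα hodd
  have h1 : v 1 = 0 := by
    have := hv_mul 1 1 one_ne_zero one_ne_zero
    rw [mul_one] at this
    omega
  have hm1 : v (-1) = 0 := by
    have := hv_mul (-1) (-1) (by simp) (by simp)
    rw [neg_mul_neg, mul_one] at this
    omega
  have hneg : ∀ x : K, x ≠ 0 → v (-x) = v x := by
    intro x hx
    have := hv_mul (-1) x (by simp) hx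
    rw [neg_one_mul] at this
    omega
  have hdiff : σ α - α ≠ 0 ∧ v (σ α - α) = v α + b := by
    obtain ⟨m, hm⟩ := hodd
    obtain ⟨x, hx0, hxσ, hxv⟩ := hk_onto (-m)
    have hp : v (x * α) = 1 := by
      rw [hv_mul x α hx0 hα]
      omega
    obtain ⟨h0, hv⟩ := hb_ram (x * α) (mul_ne_zero hx0 hα) hp
    have heq : σ (x * α) - x * α = x * (σ α - α) := by
      rw [map_mul, hxσ]
      ring
    rw [heq] at h0 hv
    have hd : σ α - α ≠ 0 := right_ne_zero_of_mul h0
    refine ⟨hd, ?_⟩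
    rw [hv_mul x _ hx0 hd] at hv
    omega
  refine ⟨?_, hdiff⟩
  obtain ⟨hd, hvd⟩ := hdiff
  have heq : σ α + α = (σ α - α) + 2 * α := by ring
  by_cases h2 : (2 : K) = 0
  · rw [heq, h2, zero_mul, add_zero]
    exact ⟨hd, hvd⟩
  · have h2α : 2 * α ≠ 0 := mul_ne_zero h2 hα
    have hv2 : v (2 * α) = 2 * e + v α := by rw [hv_mul 2 α h2 hα, hv_two]
    have hs : σ α + α ≠ 0 := by
      intro h
      have h3 : σ α - α = -(2 * α) := by linear_combination h
      rw [h3, hneg _ h2α] at hvd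
      omega
    refine ⟨hs, ?_⟩
    have ha := hv_add (σ α - α) (2 * α) hd h2α (by rwa [← heq])
    rw [← heq] at ha
    have heq2 : (σ α + α) + -(2 * α) = σ α - α := by ring
    have hb := hv_add (σ α + α) (-(2 * α)) hs (neg_ne_zero.mpr h2α) (by rwa [heq2])
    rw [heq2, hneg _ h2α] at hb
    omega
end

section
/- For every τ ∈ k with τ ≠ 0, there exists ρ ∈ K such that σ(ρ) + ρ = τ and v_K(ρ) = v_K(τ) − b. -/
/-- In the setting of a totally ramified quadratic extension `K/k` of
`2`-adic fields with nontrivial automorphism `σ`, odd ramification number `b < 2 e_k`: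
for every nonzero `τ ∈ k` there exists `ρ ∈ K` with `σ ρ + ρ = τ` and
`v ρ = v τ - b`. -/
theorem stmt_1
    (K : Type*) [Field K] (σ : K ≃+* K) (v : K → ℤ) (e b : ℤ)
    -- `v` is an additive valuation on `K`, surjective onto `ℤ`
    (hv_mul : ∀ x y : K, x ≠ 0 → y ≠ 0 → v (x * y) = v x + v y)
    (hv_add : ∀ x y : K, x ≠ 0 → y ≠ 0 → x + y ≠ 0 → min (v x) (v y) ≤ v (x + y))
    (hv_surj : ∀ n : ℤ, ∃ x : K, x ≠ 0 ∧ v x = n)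
    -- `K` is complete with respect to `v` (it is a finite extension of `ℚ₂`)
    (hv_complete : ∀ f : ℕ → K,
      (∀ m : ℕ, f (m + 1) - f m = 0 ∨ (m : ℤ) ≤ v (f (m + 1) - f m)) →
      ∃ x : K, ∀ m : ℕ, x - f m = 0 ∨ (m : ℤ) ≤ v (x - f m))
    -- `σ` is the nontrivial automorphism of the quadratic extension `K/k`,
    -- where `k` is its fixed field; `σ` preserves the valuation
    (hσ_invol : ∀ x : K, σ (σ x) = x) (hσ_ne : ∃ x : K, σ x ≠ x)
    (hσ_val : ∀ x : K, x ≠ 0 → v (σ x) = v x)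
    -- `K/k` is totally ramified:  `v (kˣ) = 2ℤ`
    (hk_even : ∀ x : K, x ≠ 0 → σ x = x → 2 ∣ v x)
    (hk_onto : ∀ m : ℤ, ∃ x : K, x ≠ 0 ∧ σ x = x ∧ v x = 2 * m)
    -- the absolute ramification index of `k` is `e`, so `v 2 = 2 e`
    (hv_two : v (2 : K) = 2 * e)
    -- `b` is the ramification number of `K/k`; it is odd and `b < 2 e`
    (hb_odd : Odd b) (hb_lt : b < 2 * e)
    (hb_ram : ∀ π : K, π ≠ 0 → v π = 1 → σ π - π ≠ 0 ∧ v (σ π - π) = b + 1) :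
    ∀ τ : K, τ ≠ 0 → σ τ = τ →
      ∃ ρ : K, ρ ≠ 0 ∧ σ ρ + ρ = τ ∧ v ρ = v τ - b := by
  intro τ hτ hτσ
  obtain ⟨π, hπ, hvπ⟩ := hv_surj 1
  obtain ⟨hd, hvd⟩ := hb_ram π hπ hvπ
  have v1 : v 1 = 0 := by
    have := hv_mul 1 1 one_ne_zero one_ne_zero
    rw [mul_one] at this
    omega
  have hm1 : (-1 : K) ≠ 0 := neg_ne_zero.mpr one_ne_zero
  have vm1 : v (-1) = 0 := by
    have := hv_mul (-1) (-1) hm1 hm1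
    rw [neg_mul_neg, mul_one, v1] at this
    omega
  have vneg : ∀ x : K, x ≠ 0 → v (-x) = v x := by
    intro x hx
    have := hv_mul (-1) x hm1 hx
    rw [neg_one_mul, vm1] at this
    omega
  have key : σ π + π ≠ 0 ∧ v (σ π + π) = b + 1 := by
    by_cases h2 : (2 : K) = 0
    · have h : σ π + π = σ π - π := by linear_combination π * h2
      rw [h]
      exact ⟨hd, hvd⟩
    · have h2π : (2 : K) * π ≠ 0 := mul_ne_zero h2 hπ
      have hv2π : v (2 * π) = 2 * e + 1 := by rw [hv_mul _ _ h2 hπ, hv_two, hvπ]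
      have ht : σ π + π ≠ 0 := by
        intro h
        have h' : σ π - π = -(2 * π) := by linear_combination h
        rw [h', vneg _ h2π, hv2π] at hvd
        omega
      refine ⟨ht, ?_⟩
      have e1 : (σ π - π) + 2 * π = σ π + π := by ring
      have e2 : (σ π + π) + -(2 * π) = σ π - π := by ring
      have a1 := hv_add (σ π - π) (2 * π) hd h2π (by rw [e1]; exact ht)
      have a2 := hv_add (σ π + π) (-(2 * π)) ht (neg_ne_zero.mpr h2π) (by rw [e2]; exact hd)
      rw [e1, hvd, hv2π] at a1
      rw [e2, vneg _ h2π, hvd, hv2π] at a2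
      omega
  obtain ⟨ht, hvt⟩ := key
  have htσ : σ (σ π + π) = σ π + π := by rw [map_add, hσ_invol, add_comm]
  generalize hT : σ π + π = t at ht hvt htσ
  have hti : t⁻¹ ≠ 0 := inv_ne_zero ht
  have hvti : v t⁻¹ = -(b + 1) := by
    have := hv_mul t t⁻¹ ht hti
    rw [mul_inv_cancel₀ ht, v1, hvt] at this
    omega
  refine ⟨τ * t⁻¹ * π, mul_ne_zero (mul_ne_zero hτ hti) hπ, ?_, ?_⟩
  · rw [map_mul, map_mul, map_inv₀, hτσ, htσ, ← mul_add, hT, mul_assoc, inv_mul_cancel₀ ht, mul_one]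
  · rw [hv_mul _ _ (mul_ne_zero hτ hti) hπ, hv_mul _ _ hτ hti, hvti, hvπ]
    ring
end

section
/- If α ∈ K with α ≠ 0, v_K(α) even, and σ(α) + α = 0, then there exists θ ∈ K such that α = σ(θ) − θ and v_K(θ) = v_K(α) − b. -/
/-- In the setting of a totally ramified quadratic extension `K/k` of
`2`-adic fields with nontrivial automorphism `σ`, odd ramification number `b < 2 e_k`:
if `α ∈ K` is nonzero with `v α` even and `σ α + α = 0`, then there exists `θ ∈ K`
with `α = σ θ - θ` and `v θ = v α - b`. -/
theorem stmt_2
    (K : Type*) [Field K] (σ : K ≃+* K) (v : K → ℤ) (e b : ℤ)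
    -- `v` is an additive valuation on `K`, surjective onto `ℤ`
    (hv_mul : ∀ x y : K, x ≠ 0 → y ≠ 0 → v (x * y) = v x + v y)
    (hv_add : ∀ x y : K, x ≠ 0 → y ≠ 0 → x + y ≠ 0 → min (v x) (v y) ≤ v (x + y))
    (hv_surj : ∀ n : ℤ, ∃ x : K, x ≠ 0 ∧ v x = n)
    -- `K` is complete with respect to `v` (it is a finite extension of `ℚ₂`)
    (hv_complete : ∀ f : ℕ → K,
      (∀ m : ℕ, f (m + 1) - f m = 0 ∨ (m : ℤ) ≤ v (f (m + 1) - f m)) →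
      ∃ x : K, ∀ m : ℕ, x - f m = 0 ∨ (m : ℤ) ≤ v (x - f m))
    -- `σ` is the nontrivial automorphism of the quadratic extension `K/k`,
    -- where `k` is its fixed field; `σ` preserves the valuation
    (hσ_invol : ∀ x : K, σ (σ x) = x) (hσ_ne : ∃ x : K, σ x ≠ x)
    (hσ_val : ∀ x : K, x ≠ 0 → v (σ x) = v x)
    -- `K/k` is totally ramified:  `v (kˣ) = 2ℤ`
    (hk_even : ∀ x : K, x ≠ 0 → σ x = x → 2 ∣ v x)
    (hk_onto : ∀ m : ℤ, ∃ x : K, x ≠ 0 ∧ σ x = x ∧ v x = 2 * m)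
    -- the absolute ramification index of `k` is `e`, so `v 2 = 2 e`
    (hv_two : v (2 : K) = 2 * e)
    -- `b` is the ramification number of `K/k`; it is odd and `b < 2 e`
    (hb_odd : Odd b) (hb_lt : b < 2 * e)
    (hb_ram : ∀ π : K, π ≠ 0 → v π = 1 → σ π - π ≠ 0 ∧ v (σ π - π) = b + 1) :
    ∀ α : K, α ≠ 0 → Even (v α) → σ α + α = 0 →
      ∃ θ : K, θ ≠ 0 ∧ α = σ θ - θ ∧ v θ = v α - b := by
  intro α hα _ hσα
  obtain ⟨π, hπ, hvπ⟩ := hv_surj 1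
  obtain ⟨hδ, hvδ⟩ := hb_ram π hπ hvπ
  have hσα' : σ α = -α := eq_neg_of_add_eq_zero_left hσα
  have hc : α / (σ π - π) ≠ 0 := div_ne_zero hα hδ
  have hcδ : α / (σ π - π) * (σ π - π) = α := div_mul_cancel₀ α hδ
  have hfix : σ (α / (σ π - π)) = α / (σ π - π) := by
    rw [map_div₀, map_sub, hσ_invol, hσα', ← neg_sub (σ π) π, neg_div_neg_eq]
  have h1 := hv_mul _ _ hc hδ
  rw [hcδ, hvδ] at h1
  refine ⟨α / (σ π - π) * π, mul_ne_zero hc hπ, ?_, ?_⟩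
  · rw [map_mul, hfix, ← mul_sub, hcδ]
  · rw [hv_mul _ _ hc hπ, hvπ]
    linarith
end

section
/- Assume b_1 and b_2 are odd, b_1 < e_0, b_2 ≡ b_1 (mod 4) and 3b_1 < b_2 < 4e_0 − b_1, and set t = (b_2 − b_1)/4. Then for each choice of sign ε ∈ {+1, −1} there exists a family of elements α_m ∈ K_2 (indexed by m ∈ ℤ) with v_2(α_m) = b_2 + 4m, such that for every m the element ρ_m = σ(α_m) + α_m + σ²(α_{m−t}) + ε·α_{m−t} satisfies v_2(ρ_m) = b_2 + 2b_1 + 4m. -/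
namespace Stmt9

/-- `x` is nonzero of valuation `n`. -/
def E {K : Type*} [Field K] (v : K → ℤ) (x : K) (n : ℤ) : Prop := x ≠ 0 ∧ v x = n

/-- `x` has valuation at least `n` (zero allowed). -/
def G {K : Type*} [Field K] (v : K → ℤ) (x : K) (n : ℤ) : Prop := x = 0 ∨ n ≤ v x

structure Val {K : Type*} [Field K] (v : K → ℤ) : Prop where
  mul : ∀ x y : K, x ≠ 0 → y ≠ 0 → v (x * y) = v x + v y
  add : ∀ x y : K, x ≠ 0 → y ≠ 0 → x + y ≠ 0 → min (v x) (v y) ≤ v (x + y)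

section basics
variable {K : Type*} [Field K] {v : K → ℤ}

theorem Val.one (h : Val v) : v 1 = 0 := by
  have := h.mul 1 1 one_ne_zero one_ne_zero
  simp at this; exact this

theorem Val.neg_one (h : Val v) : v (-1) = 0 := by
  have h1 := h.mul (-1) (-1) (by simp) (by simp)
  have h2 := h.one
  simp at h1
  omega

theorem Val.neg (h : Val v) (x : K) (hx : x ≠ 0) : v (-x) = v x := by
  have h1 := h.mul (-1) x (by simp) hx
  have h2 := h.neg_one
  simp at h1
  omega

theorem Val.inv (h : Val v) (x : K) (hx : x ≠ 0) : v x⁻¹ = - v x := by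
  have h1 := h.mul x x⁻¹ hx (inv_ne_zero hx)
  rw [mul_inv_cancel₀ hx, h.one] at h1
  omega

theorem E.neg (h : Val v) {x : K} {n : ℤ} (hx : E v x n) : E v (-x) n :=
  ⟨neg_ne_zero.2 hx.1, (h.neg x hx.1).trans hx.2⟩

theorem E.mul (h : Val v) {x y : K} {n m : ℤ} (hx : E v x n) (hy : E v y m) :
    E v (x * y) (n + m) :=
  ⟨mul_ne_zero hx.1 hy.1, by rw [h.mul x y hx.1 hy.1, hx.2, hy.2]⟩

theorem E.inv (h : Val v) {x : K} {n : ℤ} (hx : E v x n) : E v x⁻¹ (-n) :=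
  ⟨inv_ne_zero hx.1, by rw [h.inv x hx.1, hx.2]⟩

theorem E.g {x : K} {n m : ℤ} (hx : E v x n) (hm : m ≤ n) : G v x m :=
  Or.inr (by rw [hx.2]; exact hm)

theorem E.cast {x : K} {n m : ℤ} (hx : E v x n) (hm : n = m) : E v x m := hm ▸ hx

theorem G.mono {x : K} {n m : ℤ} (hx : G v x n) (hm : m ≤ n) : G v x m :=
  hx.imp id fun h => hm.trans h

theorem G.neg (h : Val v) {x : K} {n : ℤ} (hx : G v x n) : G v (-x) n := by
  by_cases h0 : x = 0
  · left; simp [h0]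
  · right; rw [h.neg x h0]; exact hx.resolve_left h0

theorem G.mul (h : Val v) {x y : K} {n m : ℤ} (hx : G v x n) (hy : G v y m) :
    G v (x * y) (n + m) := by
  by_cases h0 : x = 0
  · left; simp [h0]
  by_cases h1 : y = 0
  · left; simp [h1]
  right
  rw [h.mul x y h0 h1]
  have := hx.resolve_left h0
  have := hy.resolve_left h1
  omega

theorem G.add (h : Val v) {x y : K} {n : ℤ} (hx : G v x n) (hy : G v y n) :
    G v (x + y) n := by
  by_cases h0 : x = 0
  · simpa [h0] using hy
  by_cases h1 : y = 0
  · simpa [h1] using hx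
  by_cases h2 : x + y = 0
  · left; exact h2
  right
  have := h.add x y h0 h1 h2
  have := hx.resolve_left h0
  have := hy.resolve_left h1
  omega

theorem E.add (h : Val v) {x y : K} {n m : ℤ} (hx : E v x n) (hy : G v y m) (hm : n < m) :
    E v (x + y) n := by
  by_cases h1 : y = 0
  · simpa [h1] using hx
  have hy' := hy.resolve_left h1
  have h2 : x + y ≠ 0 := by
    intro h2
    have : y = -x := by linear_combination h2
    rw [this, h.neg x hx.1, hx.2] at hy'
    omega
  refine ⟨h2, ?_⟩
  have a1 := h.add x y hx.1 h1 h2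
  have a2 := h.add (x + y) (-y) h2 (neg_ne_zero.2 h1) (by simpa using hx.1)
  rw [h.neg y h1] at a2
  have e : x + y + -y = x := by ring
  rw [e] at a2
  have := hx.2
  omega

theorem G.e {x : K} {n : ℤ} (hx : G v x n) (hn : ¬ G v x (n + 1)) : E v x n := by
  have h0 : x ≠ 0 := fun h => hn (Or.inl h)
  refine ⟨h0, ?_⟩
  have h1 := hx.resolve_left h0
  have h2 : ¬ (n + 1 ≤ v x) := fun h => hn (Or.inr h)
  omega

theorem comb (h : Val v) {P Q : ℤ → Prop} (hPQ : ∀ n, P n → Q n → False) {a b : K}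
    (ha : a = 0 ∨ P (v a)) (hb : b = 0 ∨ Q (v b)) :
    (a + b = 0 → a = 0 ∧ b = 0) ∧ (a + b = 0 ∨ (P (v (a + b)) ∨ Q (v (a + b)))) := by
  by_cases a0 : a = 0
  · subst a0
    refine ⟨fun h => ⟨rfl, by simpa using h⟩, ?_⟩
    simp only [zero_add]; tauto
  by_cases b0 : b = 0
  · subst b0
    refine ⟨fun h => ⟨by simpa using h, rfl⟩, ?_⟩
    simp only [add_zero]; tauto
  have pa := ha.resolve_left a0
  have pb := hb.resolve_left b0
  rcases lt_trichotomy (v a) (v b) with hl | hl | hl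
  · have := E.add h (⟨a0, rfl⟩ : E v a (v a)) (Or.inr le_rfl : G v b (v b)) hl
    exact ⟨fun h => (this.1 h).elim, Or.inr (Or.inl (by rw [this.2]; exact pa))⟩
  · rw [hl] at pa; exact (hPQ _ pa pb).elim
  · have := E.add h (⟨b0, rfl⟩ : E v b (v b)) (Or.inr le_rfl : G v a (v a)) hl
    rw [add_comm b a] at this
    exact ⟨fun h => (this.1 h).elim, Or.inr (Or.inr (by rw [this.2]; exact pb))⟩

end basics

structure Ctx {K : Type*} [Field K] (σ : K ≃+* K) (v : K → ℤ) (e₀ b₁ b₂ : ℤ) : Prop where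
  val : Val v
  surj : ∀ n : ℤ, ∃ x : K, E v x n
  order : ∀ x, σ (σ (σ (σ x))) = x
  order' : σ ^ 4 = 1
  inv : ∀ x : K, x ≠ 0 → v (σ x) = v x
  fix : ∀ x : K, x ≠ 0 → σ x = x → 4 ∣ v x
  onto : ∀ m : ℤ, ∃ x : K, σ x = x ∧ E v x (4 * m)
  two : G v (2 : K) (4 * e₀)
  ram1 : ∀ π : K, E v π 1 → E v (σ π - π) (b₁ + 1)
  ram2 : ∀ π : K, E v π 1 → E v (σ (σ π) - π) (b₂ + 1)
  odd1 : Odd b₁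
  odd2 : Odd b₂
  lt : b₁ < e₀
  h3 : 3 * b₁ < b₂
  h4 : b₂ < 4 * e₀ - b₁
  pos : 0 < b₁

section main
variable {K : Type*} [Field K] {σ : K ≃+* K} {v : K → ℤ} {e₀ b₁ b₂ : ℤ}

theorem Ctx.Es (h : Ctx σ v e₀ b₁ b₂) {x : K} {n : ℤ} (hx : E v x n) : E v (σ x) n :=
  ⟨by simpa using hx.1, by rw [h.inv x hx.1, hx.2]⟩

theorem Ctx.Gs (h : Ctx σ v e₀ b₁ b₂) {x : K} {n : ℤ} (hx : G v x n) : G v (σ x) n := by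
  by_cases h0 : x = 0
  · left; simp [h0]
  · right; rw [h.inv x h0]; exact hx.resolve_left h0

theorem Ctx.dim (h : Ctx σ v e₀ b₁ b₂) (x : Fin 5 → K) :
    ∃ c : Fin 5 → K, (∀ i, σ (c i) = c i) ∧ (∃ i, c i ≠ 0) ∧ ∑ i, c i * x i = 0 := by
  classical
  have hfin : IsOfFinOrder σ := isOfFinOrder_iff_pow_eq_one.2 ⟨4, by norm_num, h.order'⟩
  let H : Subgroup (RingAut K) := Subgroup.zpowers σ
  have : Finite H := hfin.finite_zpowers
  have : Fintype H := Fintype.ofFinite _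
  have hcard : Fintype.card H ≤ 4 := by
    rw [← Nat.card_eq_fintype_card]
    rw [Nat.card_zpowers]
    exact Nat.le_of_dvd (by norm_num) (orderOf_dvd_of_pow_eq_one h.order')
  have hr := FixedPoints.finrank_le_card H K
  have hnot : ¬ LinearIndependent (FixedPoints.subfield H K) x := by
    intro hl
    have := hl.fintype_card_le_finrank
    simp at this
    omega
  rw [Fintype.not_linearIndependent_iff] at hnot
  obtain ⟨g, hg, i, hi⟩ := hnot
  refine ⟨fun i => (g i : K), fun i => ?_, ⟨i, by simpa using hi⟩, ?_⟩
  · exact (g i).2 ⟨σ, Subgroup.mem_zpowers σ⟩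
  · simpa [Subfield.smul_def] using hg

theorem Ctx.f1 (h : Ctx σ v e₀ b₁ b₂) {u : K} (hu : E v u 0) :
    ∃ k, σ k = k ∧ G v (u - k) 1 := by
  by_contra hcon
  push Not at hcon
  obtain ⟨π, hπ⟩ := h.surj 1
  obtain ⟨c, hc, hne, hs⟩ := h.dim ![u, 1, π, π * π, π * (π * π)]
  have hval := h.val
  have hx : ∀ a b : K, σ a = a → σ b = b →
      (a * u + b = 0 → a = 0 ∧ b = 0) ∧ (a * u + b = 0 ∨ v (a * u + b) % 4 = 0) := by
    intro a b ha hb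
    by_cases a0 : a = 0
    · subst a0
      refine ⟨fun h => ⟨rfl, by simpa using h⟩, ?_⟩
      by_cases b0 : b = 0
      · left; simp [b0]
      · right
        have := h.fix b b0 hb
        simp only [zero_mul, zero_add]; omega
    have hk : σ (-(b / a)) = -(b / a) := by simp [ha, hb]
    have hn := hcon _ hk
    set k := -(b / a) with hkd
    have e : a * u + b = a * (u - k) := by rw [hkd]; field_simp; ring
    have uk : u - k ≠ 0 := fun h => hn (Or.inl h)
    have vk : v (u - k) < 1 := by
      by_contra hh; exact hn (Or.inr (by omega))
    rw [e]
    refine ⟨fun hh => absurd hh (mul_ne_zero a0 uk), Or.inr ?_⟩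
    rw [hval.mul _ _ a0 uk]
    have h1 := h.fix a a0 ha
    by_cases h0 : v (u - k) = 0
    · omega
    have hE : E v (-(u - k)) (v (u - k)) := E.neg hval ⟨uk, rfl⟩
    have := E.add hval hE (hu.g le_rfl) (by omega)
    have e2 : -(u - k) + u = k := by ring
    rw [e2] at this
    have h2 := h.fix k this.1 hk
    rw [this.2] at h2
    omega
  have ht : ∀ (a p : K) (j : ℤ), σ a = a → E v p j → (a * p = 0 ∨ v (a * p) % 4 = j % 4) := by
    intro a p j ha hp
    by_cases a0 : a = 0
    · left; simp [a0]
    right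
    rw [hval.mul _ _ a0 hp.1, hp.2]
    have := h.fix a a0 ha
    omega
  have x0 := hx (c 0) (c 1) (hc 0) (hc 1)
  have x1 := ht (c 2) π 1 (hc 2) hπ
  have x2 := ht (c 3) (π * π) (1 + 1) (hc 3) (E.mul hval hπ hπ)
  have x3 := ht (c 4) (π * (π * π)) (1 + (1 + 1)) (hc 4) (E.mul hval hπ (E.mul hval hπ hπ))
  have s1 := comb hval (P := fun n => n % 4 = 0) (Q := fun n => n % 4 = (1 + 1) % 4)
    (by intro n; omega) x0.2 x2
  have s2 := comb hval (P := fun n => n % 4 = 1 % 4) (Q := fun n => n % 4 = (1 + (1 + 1)) % 4)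
    (by intro n; omega) x1 x3
  have s3 := comb hval (P := fun n => n % 4 = 0 ∨ n % 4 = (1 + 1) % 4)
    (Q := fun n => n % 4 = 1 % 4 ∨ n % 4 = (1 + (1 + 1)) % 4) (by intro n; omega) s1.2 s2.2
  have hs' : c 0 * u + c 1 + c 3 * (π * π) + (c 2 * π + c 4 * (π * (π * π))) = 0 := by
    simp [Fin.sum_univ_five] at hs
    linear_combination hs
  obtain ⟨y1, y2⟩ := s3.1 hs'
  obtain ⟨z1, z2⟩ := s1.1 y1
  obtain ⟨z3, z4⟩ := s2.1 y2
  obtain ⟨w1, w2⟩ := x0.1 z1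
  have w3 : c 2 = 0 := (mul_eq_zero.1 z3).resolve_right hπ.1
  have w4 : c 3 = 0 := (mul_eq_zero.1 z2).resolve_right (mul_ne_zero hπ.1 hπ.1)
  have w5 : c 4 = 0 := (mul_eq_zero.1 z4).resolve_right
    (mul_ne_zero hπ.1 (mul_ne_zero hπ.1 hπ.1))
  obtain ⟨i, hi⟩ := hne
  apply hi
  clear hi
  fin_cases i
  · exact w1
  · exact w2
  · exact w3
  · exact w4
  · exact w5

/-- approximation form of `f = 1` -/
theorem Ctx.approx (h : Ctx σ v e₀ b₁ b₂) {x y : K} {n : ℤ} (hx : E v x n) (hy : E v y n) :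
    ∃ k, σ k = k ∧ E v k 0 ∧ G v (x - k * y) (n + 1) := by
  have hval := h.val
  have hu : E v (x * y⁻¹) 0 := (E.mul hval hx (E.inv hval hy)).cast (by ring)
  obtain ⟨k, hk, hg⟩ := h.f1 hu
  refine ⟨k, hk, ?_, ?_⟩
  · have := E.add hval hu (G.neg hval hg) (by norm_num)
    simpa using this
  · have := G.mul hval hg (hy.g le_rfl)
    have e : (x * y⁻¹ - k) * y = x - k * y := by
      have := hy.1
      field_simp
    rw [e] at this
    exact this.mono (by omega)

theorem Ctx.raise_aux (h : Ctx σ v e₀ b₁ b₂) (τ : K ≃+* K) (b : ℤ)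
    (hτ : ∀ x, σ x = x → τ x = x) (hτv : ∀ {x n}, E v x n → E v (τ x) n)
    (hr : ∀ π : K, E v π 1 → E v (τ π - π) (b + 1)) {x : K} {n : ℤ} (hn : Odd n)
    (hx : E v x n) : E v (τ x - x) (n + b) := by
  have hval := h.val
  have : n % 4 = 1 ∨ n % 4 = 3 := by
    obtain ⟨k, hk⟩ := hn; omega
  rcases this with h1 | h1
  · obtain ⟨c, hc, hcv⟩ := h.onto (n / 4)
    have hp : E v (x * c⁻¹) 1 := (E.mul hval hx (E.inv hval hcv)).cast (by omega)
    have := E.mul hval (hr _ hp) hcv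
    have e : (τ (x * c⁻¹) - x * c⁻¹) * c = τ x - x := by
      have := hcv.1
      simp only [map_mul, map_inv₀, hτ c hc]
      field_simp
    rw [e] at this
    exact this.cast (by omega)
  · obtain ⟨c, hc, hcv⟩ := h.onto (n / 4 + 1)
    have hp : E v (c * x⁻¹) 1 := (E.mul hval hcv (E.inv hval hx)).cast (by omega)
    have := E.neg hval (E.mul hval (hr _ hp) (E.mul hval (E.mul hval (hτv hx) hx) (E.inv hval hcv)))
    have e : -((τ (c * x⁻¹) - c * x⁻¹) * (τ x * x * c⁻¹)) = τ x - x := by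
      have := hcv.1
      have := hx.1
      have := (hτv hx).1
      simp only [map_mul, map_inv₀, hτ c hc]
      field_simp
      ring
    rw [e] at this
    exact this.cast (by omega)

theorem Ctx.raise1 (h : Ctx σ v e₀ b₁ b₂) {x : K} {n : ℤ} (hn : Odd n)
    (hx : E v x n) : E v (σ x - x) (n + b₁) :=
  h.raise_aux σ b₁ (fun _ h => h) h.Es h.ram1 hn hx

theorem Ctx.raise2 (h : Ctx σ v e₀ b₁ b₂) {x : K} {n : ℤ} (hn : Odd n)
    (hx : E v x n) : E v (σ (σ x) - x) (n + b₂) :=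
  h.raise_aux (σ.trans σ) b₂ (fun x h => by simp [h]) (fun hx => h.Es (h.Es hx)) h.ram2 hn hx

theorem Ctx.norm (h : Ctx σ v e₀ b₁ b₂) :
    ∃ p : K, E v p 2 ∧ σ (σ p) = p ∧ E v (σ p - p) (2 + 2 * b₁) := by
  have hval := h.val
  have := h.pos; have := h.h3; have := h.h4; have := h.lt
  obtain ⟨π, hπ⟩ := h.surj 1
  have hp : E v (π * σ (σ π)) 2 := E.mul hval hπ (h.Es (h.Es hπ))
  refine ⟨π * σ (σ π), hp, by simp [h.order, mul_comm], ?_⟩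
  obtain ⟨a, ha⟩ : ∃ a, a = (σ π - π) * π⁻¹ := ⟨_, rfl⟩
  have hav : E v a b₁ := by
    rw [ha]; exact (E.mul hval (h.ram1 _ hπ) (E.inv hval hπ)).cast (by ring)
  have hπa : σ π = π * (1 + a) := by
    rw [ha]; have := hπ.1; field_simp; ring
  have e : σ (π * σ (σ π)) - π * σ (σ π)
      = π * σ (σ π) * (a * σ (σ a) + ((σ (σ a) - a) + 2 * a)) := by
    have : σ (σ (σ π)) = σ (σ π) * (1 + σ (σ a)) := by
      conv_lhs => rw [hπa]
      simp
    rw [map_mul, this, hπa]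
    ring
  rw [e]
  have g1 := h.raise2 h.odd1 hav
  have g2 := G.mul hval h.two (hav.g le_rfl)
  have g3 := E.mul hval hav (h.Es (h.Es hav))
  have g4 := E.add hval g3 (G.add hval (g1.g (m := 2 * b₁ + 1) (by omega))
    (g2.mono (m := 2 * b₁ + 1) (by omega))) (by omega)
  exact (E.mul hval hp g4).cast (by ring)

/-- leading term decomposition in `K₁` -/
theorem Ctx.lead (h : Ctx σ v e₀ b₁ b₂) {w : K} {n : ℤ} (hw : E v w n) (hf : σ (σ w) = w) :
    ∃ w0, σ (σ w0) = w0 ∧ G v (w - w0) (n + 1) ∧ (n % 2 = 0) ∧ G v (σ w0 - w0) (n + 2 * b₁) ∧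
      (n % 4 = 2 → E v (σ w0 - w0) (n + 2 * b₁)) := by
  have hval := h.val
  have := h.pos; have := h.h3; have := h.h4; have := h.lt
  have hn : n % 2 = 0 := by
    by_contra hn
    have := h.raise2 (by rw [Int.odd_iff]; omega) hw
    exact this.1 (by rw [hf]; ring)
  obtain ⟨p, hp, hpf, hpv⟩ := h.norm
  have hc : n % 4 = 0 ∨ n % 4 = 2 := by omega
  rcases hc with hc | hc
  · obtain ⟨c, hc, hcv⟩ := h.onto (n / 4)
    obtain ⟨k, hk, hk0, hg⟩ := h.approx hw (hcv.cast (by omega))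
    refine ⟨k * c, by simp [hk, hc], hg, hn, Or.inl (by simp [hk, hc]), by omega⟩
  · obtain ⟨c, hc, hcv⟩ := h.onto (n / 4)
    obtain ⟨k, hk, hk0, hg⟩ := h.approx hw ((E.mul hval hcv hp).cast (by omega))
    have hE : E v (σ (k * (c * p)) - k * (c * p)) (n + 2 * b₁) := by
      have e : σ (k * (c * p)) - k * (c * p) = k * (c * (σ p - p)) := by
        simp [hk, hc]; ring
      rw [e]
      exact (E.mul hval hk0 (E.mul hval hcv hpv)).cast (by omega)
    exact ⟨k * (c * p), by simp [hk, hc, hpf], hg, hn, hE.g le_rfl, fun _ => hE⟩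

theorem Ctx.k1_aux (h : Ctx σ v e₀ b₁ b₂) (N : ℤ) (j : ℕ) : ∀ (w : K) (n : ℤ), σ (σ w) = w →
    G v w n → N - j ≤ n → G v (σ w - w) (min N (n + 2 * b₁)) := by
  have hval := h.val
  induction j with
  | zero =>
    intro w n hf hw hn
    rw [sub_eq_add_neg]
    exact (G.add hval (h.Gs hw) (G.neg hval hw)).mono (by simp at hn; omega)
  | succ j ih =>
    intro w n hf hw hn
    by_cases hw1 : G v w (n + 1)
    · exact (ih w (n + 1) hf hw1 (by push_cast at hn; omega)).mono (by omega)
    have hE := hw.e hw1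
    obtain ⟨w0, f0, g0, -, g1, -⟩ := h.lead hE hf
    have g2 := ih (w - w0) (n + 1) (by simp [hf, f0]) g0 (by push_cast at hn; omega)
    have e : σ w - w = (σ (w - w0) - (w - w0)) + (σ w0 - w0) := by simp; ring
    rw [e]
    exact G.add hval (g2.mono (by omega)) (g1.mono (by omega))

theorem Ctx.k1 (h : Ctx σ v e₀ b₁ b₂) {w : K} {n : ℤ} (hf : σ (σ w) = w)
    (hw : G v w n) : G v (σ w - w) (n + 2 * b₁) := by
  have := h.k1_aux (n + 2 * b₁) (2 * b₁).toNat w n hf hw (by have := h.pos; omega)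
  simpa using this

theorem Ctx.k1e (h : Ctx σ v e₀ b₁ b₂) {w : K} {n : ℤ} (hf : σ (σ w) = w)
    (hw : E v w n) (hn : n % 4 = 2) : E v (σ w - w) (n + 2 * b₁) := by
  obtain ⟨w0, f0, g0, -, -, g1⟩ := h.lead hw hf
  have g2 := h.k1 (w := w - w0) (by simp [hf, f0]) g0
  have e : σ w - w = (σ w0 - w0) + (σ (w - w0) - (w - w0)) := by simp; ring
  rw [e]
  exact E.add h.val (g1 hn) g2 (by omega)

/-- the key property of the sum of the two difference terms -/
theorem Ctx.key (h : Ctx σ v e₀ b₁ b₂) {t : ℤ} (ht : b₂ - b₁ = 4 * t) {a a' : K} {m : ℤ}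
    (ha : E v a (b₂ + 4 * m)) (ha' : E v a' (b₁ + 4 * m)) :
    let y := (σ a - a) + (σ (σ a') - a')
    y ≠ 0 ∧ v y ≤ b₂ + 3 * b₁ + 4 * m ∧ (Odd (v y) → v y = b₂ + 2 * b₁ + 4 * m) := by
  intro y
  have hval := h.val
  have := h.pos; have := h.h3; have := h.h4; have := h.lt
  have o1 := Int.odd_iff.1 h.odd1
  have o2 := Int.odd_iff.1 h.odd2
  have z1 := h.raise2 (by rw [Int.odd_iff]; omega) ha'
  have d1 := h.raise1 (by rw [Int.odd_iff]; omega) ha'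
  have t1 := G.mul hval h.two (ha'.g le_rfl)
  have s1 := E.add hval z1 t1 (by omega)
  have s2 := h.k1e (by simp [h.order, map_ofNat σ 2]; ring) s1 (by omega)
  have t2 := G.mul hval h.two (d1.g le_rfl)
  have t3 := G.mul hval h.two (z1.g le_rfl)
  have A := h.raise2 (by rw [Int.odd_iff]; omega) ha
  have T : E v (σ y + y) (b₂ + 3 * b₁ + 4 * m) := by
    have e : σ y + y = (σ (σ (σ a') - a' + 2 * a') - (σ (σ a') - a' + 2 * a'))
      + ((σ (σ a) - a) + (- (2 * (σ a' - a')) + 2 * (σ (σ a') - a'))) := by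
      simp [y, map_ofNat σ 2]; ring
    rw [e]
    refine (E.add hval s2 (m := b₂ + 3 * b₁ + 4 * m + 1) ?_ (by omega)).cast (by omega)
    exact G.add hval (A.g (by omega)) (G.add hval ((G.neg hval t2).mono (by omega))
      (t3.mono (by omega)))
  have y0 : y ≠ 0 := by
    intro hy
    exact T.1 (by simp [hy])
  have hyE : E v y (v y) := ⟨y0, rfl⟩
  refine ⟨y0, ?_, fun ho => ?_⟩
  · have := (G.add hval (h.Gs (hyE.g le_rfl)) (hyE.g le_rfl)).resolve_left T.1
    rw [T.2] at this
    exact this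
  · have r := h.raise1 ho hyE
    have r2 := E.add hval r (G.mul hval h.two (hyE.g le_rfl)) (by omega)
    have e : σ y - y + 2 * y = σ y + y := by ring
    rw [e] at r2
    have := r2.2.symm.trans T.2
    omega

theorem Ctx.climb (h : Ctx σ v e₀ b₁ b₂) (τ : K ≃+* K) (b : ℤ) (hb : Odd b)
    (hτ : ∀ x, σ x = x → τ x = x)
    (hr : ∀ {x n}, Odd n → E v x n → E v (τ x - x) (n + b))
    {z : K} {n T V : ℤ} (hn : Even n) (hz : E v z n)
    (hF : ∀ a, E v a (n - b) → (τ a - a) + z ≠ 0 ∧ v ((τ a - a) + z) ≤ V ∧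
      (Odd (v ((τ a - a) + z)) → v ((τ a - a) + z) = T)) :
    ∃ a, E v a (n - b) ∧ E v ((τ a - a) + z) T := by
  have hval := h.val
  have imp : ∀ (y : K) (n : ℤ), Even n → E v y n →
      ∃ β, E v β (n - b) ∧ G v ((τ β - β) + y) (n + 1) := by
    intro y n hn hy
    obtain ⟨β, hβ⟩ := h.surj (n - b)
    have hd := hr (hn.sub_odd hb) hβ
    obtain ⟨k, hk, hk0, hg⟩ := h.approx hy (hd.cast (by ring))
    refine ⟨-(k * β), (E.neg hval (E.mul hval hk0 hβ)).cast (by ring), ?_⟩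
    have e : τ (-(k * β)) - -(k * β) + y = y - k * (τ β - β) := by
      simp [hτ k hk]; ring
    rw [e]; exact hg
  have main : ∀ j : ℕ, ∃ a, E v a (n - b) ∧ (E v ((τ a - a) + z) T ∨
      G v ((τ a - a) + z) (n + 1 + j)) := by
    intro j
    induction j with
    | zero =>
      obtain ⟨β, h1, h2⟩ := imp z n hn hz
      exact ⟨β, h1, Or.inr (by simpa using h2)⟩
    | succ j ih =>
      obtain ⟨a, ha, hc⟩ := ih
      rcases hc with hc | hc
      · exact ⟨a, ha, Or.inl hc⟩
      by_cases hg : G v ((τ a - a) + z) (n + 1 + j + 1)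
      · exact ⟨a, ha, Or.inr (hg.mono (by push_cast; omega))⟩
      have hE := hc.e hg
      obtain ⟨f1, f2, f3⟩ := hF a ha
      rcases Int.even_or_odd (n + 1 + j) with ho | ho
      · obtain ⟨β, h1, h2⟩ := imp _ _ ho hE
        refine ⟨a + β, E.add hval ha (h1.g le_rfl) (by omega), Or.inr ?_⟩
        have e : τ (a + β) - (a + β) + z = τ β - β + (τ a - a + z) := by simp; ring
        rw [e]
        exact h2.mono (by push_cast; omega)
      · exact ⟨a, ha, Or.inl ⟨f1, f3 (by rw [hE.2]; exact ho)⟩⟩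
  obtain ⟨a, ha, hc⟩ := main (V - n).toNat
  refine ⟨a, ha, ?_⟩
  rcases hc with hc | hc
  · exact hc
  obtain ⟨f1, f2, f3⟩ := hF a ha
  have := hc.resolve_left f1
  omega

theorem Ctx.up (h : Ctx σ v e₀ b₁ b₂) {t : ℤ} (ht : b₂ - b₁ = 4 * t) (m : ℤ) {a' : K}
    (ha' : E v a' (b₁ + 4 * m)) : ∃ a, E v a (b₂ + 4 * m) ∧
      E v ((σ a - a) + (σ (σ a') - a')) (b₂ + 2 * b₁ + 4 * m) := by
  have o1 := Int.odd_iff.1 h.odd1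
  have o2 := Int.odd_iff.1 h.odd2
  have z1 := h.raise2 (by rw [Int.odd_iff]; omega) ha'
  have e : b₁ + 4 * m + b₂ - b₁ = b₂ + 4 * m := by ring
  have := h.climb σ b₁ h.odd1 (fun _ h => h) h.raise1 (by rw [Int.even_iff]; omega) z1
    (T := b₂ + 2 * b₁ + 4 * m) (V := b₂ + 3 * b₁ + 4 * m)
    (fun a ha => h.key ht (ha.cast e) ha')
  rwa [e] at this

theorem Ctx.down (h : Ctx σ v e₀ b₁ b₂) {t : ℤ} (ht : b₂ - b₁ = 4 * t) (m : ℤ) {a : K}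
    (ha : E v a (b₂ + 4 * m)) : ∃ a', E v a' (b₁ + 4 * m) ∧
      E v ((σ a - a) + (σ (σ a') - a')) (b₂ + 2 * b₁ + 4 * m) := by
  have o1 := Int.odd_iff.1 h.odd1
  have o2 := Int.odd_iff.1 h.odd2
  have z1 := h.raise1 (by rw [Int.odd_iff]; omega) ha
  have e : b₂ + 4 * m + b₁ - b₂ = b₁ + 4 * m := by ring
  have := h.climb (σ.trans σ) b₂ h.odd2 (fun x h => by simp [h]) h.raise2
    (by rw [Int.even_iff]; omega) z1
    (T := b₂ + 2 * b₁ + 4 * m) (V := b₂ + 3 * b₁ + 4 * m)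
    (fun a' ha' => by
      have := h.key ht ha (ha'.cast e)
      rw [add_comm] at this
      exact this)
  rw [e] at this
  obtain ⟨a', x, y⟩ := this
  exact ⟨a', x, by rw [add_comm]; exact y⟩

/-- two-sided dependent choice -/
theorem chain {X : Type*} (P : ℤ → X → Prop) (R : ℤ → X → X → Prop)
    (h0 : ∃ x, P 0 x) (hup : ∀ q x, P q x → ∃ y, P (q + 1) y ∧ R (q + 1) y x)
    (hdn : ∀ q x, P q x → ∃ y, P (q - 1) y ∧ R q x y) :
    ∃ A : ℤ → X, (∀ q, P q (A q)) ∧ ∀ q, R q (A q) (A (q - 1)) := by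
  classical
  obtain ⟨x0, hx0⟩ := h0
  choose U hU1 hU2 using hup
  choose D hD1 hD2 using hdn
  let F : (n : ℕ) → {x // P (n : ℤ) x} := fun n =>
    Nat.rec ⟨x0, by simpa using hx0⟩
      (fun n x => ⟨U n x.1 x.2, by have := hU1 n x.1 x.2; push_cast; exact this⟩) n
  let B : (n : ℕ) → {x // P (-(n : ℤ)) x} := fun n =>
    Nat.rec ⟨x0, by simpa using hx0⟩
      (fun n x => ⟨D (-(n : ℤ)) x.1 x.2, by
        have := hD1 (-(n : ℤ)) x.1 x.2
        have e : -((n + 1 : ℕ) : ℤ) = -(n : ℤ) - 1 := by push_cast; ring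
        rw [e]; exact this⟩) n
  have hF : ∀ n : ℕ, R (n + 1) (F (n + 1)).1 (F n).1 := fun n => hU2 n _ (F n).2
  have hB : ∀ n : ℕ, R (-(n : ℤ)) (B n).1 (B (n + 1)).1 := fun n => hD2 (-(n : ℤ)) _ (B n).2
  have h00 : (F 0).1 = (B 0).1 := rfl
  let A : ℤ → X := fun q => if 0 ≤ q then (F q.toNat).1 else (B (-q).toNat).1
  have AF : ∀ n : ℕ, A n = (F n).1 := fun n => by simp [A]
  have AB : ∀ n : ℕ, A (-(n : ℤ)) = (B n).1 := fun n => by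
    rcases n with _ | n
    · simp only [A]; simpa using h00
    · have : ¬ (0 : ℤ) ≤ -((n + 1 : ℕ) : ℤ) := by push_cast; omega
      have hc : ∀ i j : ℕ, i = j → (B i).1 = (B j).1 := by rintro i _ rfl; rfl
      simp only [A, if_neg this]
      exact hc _ _ (by omega)
  refine ⟨A, fun q => ?_, fun q => ?_⟩
  · rcases Int.eq_nat_or_neg q with ⟨n, rfl | rfl⟩
    · rw [AF]; exact (F n).2
    · rw [AB]; exact (B n).2
  · rcases le_or_gt q 0 with hq | hq
    · obtain ⟨n, hn⟩ : ∃ n : ℕ, q = -(n : ℤ) := ⟨(-q).toNat, by omega⟩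
      have e : q - 1 = -((n + 1 : ℕ) : ℤ) := by push_cast; omega
      rw [e, AB, hn, AB]
      exact hB n
    · obtain ⟨n, hn⟩ : ∃ n : ℕ, q = (n : ℤ) + 1 := ⟨(q - 1).toNat, by omega⟩
      have e : q - 1 = (n : ℤ) := by omega
      have e2 : q = ((n + 1 : ℕ) : ℤ) := by push_cast; exact hn
      rw [e, AF, e2, AF]
      exact_mod_cast hF n

theorem Ctx.final (h : Ctx σ v e₀ b₁ b₂) {t : ℤ} (ht : b₂ - b₁ = 4 * t) :
    ∃ α : ℤ → K, (∀ m, E v (α m) (b₂ + 4 * m)) ∧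
      ∀ m, E v ((σ (α m) - α m) + (σ (σ (α (m - t))) - α (m - t))) (b₂ + 2 * b₁ + 4 * m) := by
  have := h.pos; have := h.h3
  have tpos : 0 < t := by omega
  have hA : ∀ r : ℤ, ∃ A : ℤ → K, (∀ q, E v (A q) (b₂ + 4 * (r + t * q))) ∧
      ∀ q, E v ((σ (A q) - A q) + (σ (σ (A (q - 1))) - A (q - 1)))
        (b₂ + 2 * b₁ + 4 * (r + t * q)) := by
    intro r
    refine chain (fun q x => E v x (b₂ + 4 * (r + t * q)))
      (fun q x y => E v ((σ x - x) + (σ (σ y) - y)) (b₂ + 2 * b₁ + 4 * (r + t * q)))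
      (h.surj _) ?_ ?_
    · intro q x hx
      exact h.up ht (r + t * (q + 1)) (hx.cast (by linear_combination ht))
    · intro q x hx
      obtain ⟨y, h1, h2⟩ := h.down ht (r + t * q) hx
      exact ⟨y, h1.cast (by linear_combination -ht), h2⟩
  choose A hA1 hA2 using hA
  refine ⟨fun m => A (m % t) (m / t), fun m => ?_, fun m => ?_⟩
  · exact (hA1 (m % t) (m / t)).cast (by rw [Int.emod_add_mul_ediv])
  · have e1 : (m - t) % t = m % t := by simp
    have e2 : (m - t) / t = m / t - 1 := by
      rw [Int.sub_ediv_of_dvd _ (dvd_refl t), Int.ediv_self tpos.ne']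
    simp only [e1, e2]
    exact (hA2 (m % t) (m / t)).cast (by rw [Int.emod_add_mul_ediv])

end main
end Stmt9

/-- **Lemma 3.2.**  Let `K₂/K₀` be a totally ramified cyclic quartic
extension of `2`-adic fields with odd ramification break numbers `b₁ < b₂`, `b₁ < e₀`,
`b₂ ≡ b₁ (mod 4)` (equivalently `3 b₁ < b₂ < 4 e₀ - b₁`), and `t = (b₂ - b₁)/4`.
Then for each sign `ε = ±1` there is a family `α_m ∈ K₂` with `v (α_m) = b₂ + 4 m`
such that `ρ_m = σ(α_m) + α_m + σ²(α_{m-t}) + ε • α_{m-t}` has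
`v (ρ_m) = b₂ + 2 b₁ + 4 m`. -/
theorem stmt_9
    (K : Type*) [Field K] (σ : K ≃+* K) (v : K → ℤ) (e₀ b₁ b₂ : ℤ)
    -- `v` is the normalized additive valuation of `K = K₂`, surjective onto `ℤ`
    (hv_mul : ∀ x y : K, x ≠ 0 → y ≠ 0 → v (x * y) = v x + v y)
    (hv_add : ∀ x y : K, x ≠ 0 → y ≠ 0 → x + y ≠ 0 → min (v x) (v y) ≤ v (x + y))
    (hv_surj : ∀ n : ℤ, ∃ x : K, x ≠ 0 ∧ v x = n)
    -- `K` is complete with respect to `v` (it is a finite extension of `ℚ₂`)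
    (hv_complete : ∀ f : ℕ → K,
      (∀ m : ℕ, f (m + 1) - f m = 0 ∨ (m : ℤ) ≤ v (f (m + 1) - f m)) →
      ∃ x : K, ∀ m : ℕ, x - f m = 0 ∨ (m : ℤ) ≤ v (x - f m))
    -- `σ` generates the cyclic Galois group of order `4` of `K₂/K₀`;
    -- `σ` preserves the valuation.  (The fixed field of `σ ^ 2` is `K₁`.)
    (hσ_order : σ ^ 4 = 1) (hσ_ne : σ ^ 2 ≠ 1)
    (hσ_val : ∀ x : K, x ≠ 0 → v (σ x) = v x)
    -- `K₂/K₀` is totally ramified of degree `4`:  `v (K₀ˣ) = 4ℤ`,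
    -- where `K₀` is the fixed field of `σ`
    (hfix_val : ∀ x : K, x ≠ 0 → σ x = x → 4 ∣ v x)
    (hfix_onto : ∀ m : ℤ, ∃ x : K, x ≠ 0 ∧ σ x = x ∧ v x = 4 * m)
    -- the absolute ramification index of `K₀` is `e₀`, so `v 2 = 4 e₀`
    (hv_two : v (2 : K) = 4 * e₀)
    -- `b₁ < b₂` are the ramification break numbers of `K₂/K₀`
    (hb_lt : b₁ < b₂)
    (hb_ram : ∀ π : K, π ≠ 0 → v π = 1 →
      (σ π - π ≠ 0 ∧ v (σ π - π) = b₁ + 1) ∧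
      ((σ ^ 2) π - π ≠ 0 ∧ v ((σ ^ 2) π - π) = b₂ + 1))
    (hb₁_odd : Odd b₁) (hb₂_odd : Odd b₂) (hb₁_lt : b₁ < e₀)
    (h3 : 3 * b₁ < b₂) (h4 : b₂ < 4 * e₀ - b₁)
    (t : ℤ) (ht : b₂ - b₁ = 4 * t) :
    ∀ ε : K, (ε = 1 ∨ ε = -1) →
      ∃ α : ℤ → K,
        (∀ m : ℤ, α m ≠ 0 ∧ v (α m) = b₂ + 4 * m) ∧
        (∀ m : ℤ,
          σ (α m) + α m + ((σ ^ 2) (α (m - t)) + ε * α (m - t)) ≠ 0 ∧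
          v (σ (α m) + α m + ((σ ^ 2) (α (m - t)) + ε * α (m - t))) =
            b₂ + 2 * b₁ + 4 * m) := by
  have hval : Stmt9.Val v := ⟨hv_mul, hv_add⟩
  have hpos : 0 < b₁ := by
    obtain ⟨π, h0, h1⟩ := hv_surj 1
    have hr := (hb_ram π h0 h1).1
    have g : Stmt9.G v (σ π - π) 1 := by
      rw [sub_eq_add_neg]
      refine Stmt9.G.add hval (Or.inr ?_) (Stmt9.G.neg hval (Or.inr h1.ge))
      rw [hσ_val π h0, h1]
    have := g.resolve_left hr.1
    have o1 := Int.odd_iff.1 hb₁_odd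
    omega
  have ho : ∀ x, σ (σ (σ (σ x))) = x := fun x => by
    have := congrArg (fun f : K ≃+* K => f x) hσ_order
    exact this
  have hs2 : ∀ x, (σ ^ 2) x = σ (σ x) := fun x => rfl
  have h : Stmt9.Ctx σ v e₀ b₁ b₂ := {
    val := hval
    surj := hv_surj
    order := ho
    order' := hσ_order
    inv := hσ_val
    fix := hfix_val
    onto := fun m => by
      obtain ⟨x, h1, h2, h3⟩ := hfix_onto m
      exact ⟨x, h2, h1, h3⟩
    two := Or.inr hv_two.ge
    ram1 := fun π hπ => (hb_ram π hπ.1 hπ.2).1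
    ram2 := fun π hπ => (hb_ram π hπ.1 hπ.2).2
    odd1 := hb₁_odd
    odd2 := hb₂_odd
    lt := hb₁_lt
    h3 := h3
    h4 := h4
    pos := hpos }
  intro ε hε
  obtain ⟨α, h1, h2⟩ := h.final ht
  refine ⟨α, h1, fun m => ?_⟩
  have t1 := Stmt9.G.mul hval h.two ((h1 m).g le_rfl)
  have t2 := Stmt9.G.mul hval h.two ((h1 (m - t)).g le_rfl)
  have t3 : Stmt9.G v ((ε + 1) * α (m - t)) (4 * e₀ + (b₂ + 4 * (m - t))) := by
    rcases hε with rfl | rfl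
    · rw [one_add_one_eq_two]; exact t2
    · left; simp
  have := Stmt9.E.add hval (h2 m) (m := b₂ + 2 * b₁ + 4 * m + 1)
    (Stmt9.G.add hval (t1.mono (by omega)) (t3.mono (by omega))) (by omega)
  have e : σ (α m) + α m + ((σ ^ 2) (α (m - t)) + ε * α (m - t)) =
      σ (α m) - α m + (σ (σ (α (m - t))) - α (m - t)) + (2 * α m + (ε + 1) * α (m - t)) := by
    rw [hs2]; ring
  rw [e]
  exact this
end

section
/- Assume b_1 and b_2 are odd, b_1 < e_0, and either b_2 = 3b_1 or b_2 = 4e_0 − b_1; set s = (b_2 + b_1)/4. Then there exists a family of elements α_m ∈ K_2 (indexed by m ∈ ℤ) with v_2(α_m) = b_2 + 4m, such that for every m the element ρ_m = (σ+1)α_m + (σ+1)(σ²+1)α_{m−s} (where (σ+1)x denotes σ(x) + x and (σ²+1)x denotes σ²(x) + x) satisfies v_2(ρ_m) = 2b_2 − b_1 + 4m. In particular, if b_2 = 3b_1 then v_2(ρ_m) = b_2 + 2b_1 + 4m. -/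
/-- **Lemma 3.3.**  Let `K₂/K₀` be a totally ramified cyclic quartic
extension of `2`-adic fields with odd ramification break numbers `b₁ < b₂`, `b₁ < e₀`,
and `b₂ = 3 b₁` or `b₂ = 4 e₀ - b₁`; set `s = (b₂ + b₁)/4`.  There is a family
`α_m ∈ K₂` with `v (α_m) = b₂ + 4 m` such that
`ρ_m = (σ+1) α_m + (σ+1)(σ²+1) α_{m-s}` has `v (ρ_m) = 2 b₂ - b₁ + 4 m`;
in particular if `b₂ = 3 b₁` then `v (ρ_m) = b₂ + 2 b₁ + 4 m`. -/
theorem stmt_10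
    (K : Type*) [Field K] (σ : K ≃+* K) (v : K → ℤ) (e₀ b₁ b₂ : ℤ)
    -- `v` is the normalized additive valuation of `K = K₂`, surjective onto `ℤ`
    (hv_mul : ∀ x y : K, x ≠ 0 → y ≠ 0 → v (x * y) = v x + v y)
    (hv_add : ∀ x y : K, x ≠ 0 → y ≠ 0 → x + y ≠ 0 → min (v x) (v y) ≤ v (x + y))
    (hv_surj : ∀ n : ℤ, ∃ x : K, x ≠ 0 ∧ v x = n)
    -- `K` is complete with respect to `v` (it is a finite extension of `ℚ₂`)
    (hv_complete : ∀ f : ℕ → K,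
      (∀ m : ℕ, f (m + 1) - f m = 0 ∨ (m : ℤ) ≤ v (f (m + 1) - f m)) →
      ∃ x : K, ∀ m : ℕ, x - f m = 0 ∨ (m : ℤ) ≤ v (x - f m))
    -- `σ` generates the cyclic Galois group of order `4` of `K₂/K₀`;
    -- `σ` preserves the valuation.  (The fixed field of `σ ^ 2` is `K₁`.)
    (hσ_order : σ ^ 4 = 1) (hσ_ne : σ ^ 2 ≠ 1)
    (hσ_val : ∀ x : K, x ≠ 0 → v (σ x) = v x)
    -- `K₂/K₀` is totally ramified of degree `4`:  `v (K₀ˣ) = 4ℤ`,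
    -- where `K₀` is the fixed field of `σ`
    (hfix_val : ∀ x : K, x ≠ 0 → σ x = x → 4 ∣ v x)
    (hfix_onto : ∀ m : ℤ, ∃ x : K, x ≠ 0 ∧ σ x = x ∧ v x = 4 * m)
    -- the absolute ramification index of `K₀` is `e₀`, so `v 2 = 4 e₀`
    (hv_two : v (2 : K) = 4 * e₀)
    -- `b₁ < b₂` are the ramification break numbers of `K₂/K₀`
    (hb_lt : b₁ < b₂)
    (hb_ram : ∀ π : K, π ≠ 0 → v π = 1 →
      (σ π - π ≠ 0 ∧ v (σ π - π) = b₁ + 1) ∧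
      ((σ ^ 2) π - π ≠ 0 ∧ v ((σ ^ 2) π - π) = b₂ + 1))
    (hb₁_odd : Odd b₁) (hb₂_odd : Odd b₂) (hb₁_lt : b₁ < e₀)
    (hcase : b₂ = 3 * b₁ ∨ b₂ = 4 * e₀ - b₁)
    (s : ℤ) (hs : b₂ + b₁ = 4 * s) :
    ∃ α : ℤ → K,
      (∀ m : ℤ, α m ≠ 0 ∧ v (α m) = b₂ + 4 * m) ∧
      (∀ m : ℤ,
        (σ (α m) + α m) +
            (σ ((σ ^ 2) (α (m - s)) + α (m - s)) + ((σ ^ 2) (α (m - s)) + α (m - s))) ≠ 0 ∧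
        v ((σ (α m) + α m) +
            (σ ((σ ^ 2) (α (m - s)) + α (m - s)) + ((σ ^ 2) (α (m - s)) + α (m - s)))) =
          2 * b₂ - b₁ + 4 * m ∧
        (b₂ = 3 * b₁ →
          v ((σ (α m) + α m) +
              (σ ((σ ^ 2) (α (m - s)) + α (m - s)) + ((σ ^ 2) (α (m - s)) + α (m - s)))) =
            b₂ + 2 * b₁ + 4 * m)) := by
  have hs2 : ∀ x, (σ ^ 2) x = σ (σ x) := fun x => by simp [pow_two]
  have hs4 : ∀ x, σ (σ (σ (σ x))) = x := by
    intro x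
    have h := congrArg (fun f : K ≃+* K => f x) hσ_order
    simpa [pow_succ] using h
  simp only [hs2] at hb_ram ⊢
  obtain ⟨V, hV⟩ : ∃ V : K → ℤ → Prop, ∀ x n, V x n ↔ (x ≠ 0 ∧ v x = n) :=
    ⟨fun x n => x ≠ 0 ∧ v x = n, fun _ _ => Iff.rfl⟩
  have hne : ∀ {x n}, V x n → x ≠ 0 := fun h => ((hV _ _).1 h).1
  have hval : ∀ {x n}, V x n → v x = n := fun h => ((hV _ _).1 h).2
  have vmul : ∀ {x y n m}, V x n → V y m → V (x * y) (n + m) := by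
    intro x y n m hx hy
    rw [hV] at *
    exact ⟨mul_ne_zero hx.1 hy.1, by rw [hv_mul _ _ hx.1 hy.1, hx.2, hy.2]⟩
  have v1 : v 1 = 0 := by
    have := hv_mul 1 1 one_ne_zero one_ne_zero
    rw [mul_one] at this
    omega
  have vneg1 : v (-1) = 0 := by
    have := hv_mul (-1) (-1) (by simp) (by simp)
    rw [neg_mul_neg, mul_one] at this
    omega
  have V1 : V 1 0 := (hV _ _).2 ⟨one_ne_zero, v1⟩
  have vneg : ∀ {x n}, V x n → V (-x) n := by
    intro x n hx
    have := vmul ((hV (-1) 0).2 ⟨by simp, vneg1⟩) hx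
    simpa using this
  have vinv : ∀ {x n}, V x n → V x⁻¹ (-n) := by
    intro x n hx
    have hx' := (hV _ _).1 hx
    refine (hV _ _).2 ⟨inv_ne_zero hx'.1, ?_⟩
    have := hv_mul x x⁻¹ hx'.1 (inv_ne_zero hx'.1)
    rw [mul_inv_cancel₀ hx'.1] at this
    omega
  have vdiv : ∀ {x y n m}, V x n → V y m → V (x / y) (n - m) := by
    intro x y n m hx hy
    rw [div_eq_mul_inv, sub_eq_add_neg]
    exact vmul hx (vinv hy)
  have vadd : ∀ {x y n m}, V x n → V y m → n < m → V (x + y) n := by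
    intro x y n m hx hy hnm
    have hx' := (hV _ _).1 hx
    have hy' := (hV _ _).1 hy
    have hxy : x + y ≠ 0 := by
      intro h
      have e : x = -y := by linear_combination h
      have := hval (vneg hy)
      rw [← e] at this
      omega
    have h1 := hv_add x y hx'.1 hy'.1 hxy
    have hny := (hV _ _).1 (vneg hy)
    have h2 := hv_add (x + y) (-y) hxy hny.1 (by simpa using hx'.1)
    rw [add_neg_cancel_right] at h2
    refine (hV _ _).2 ⟨hxy, ?_⟩
    rw [hx'.2, hy'.2] at h1
    rw [hx'.2, hny.2] at h2
    rcases min_le_iff.1 h1 with h | h <;> rcases min_le_iff.1 h2 with h' | h' <;> omega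
  have vadd' : ∀ {x y n m}, V x n → V y m → m < n → V (x + y) m := by
    intro x y n m hx hy h
    rw [add_comm]
    exact vadd hy hx h
  have vsig : ∀ {x n}, V x n → V (σ x) n := by
    intro x n hx
    have hx' := (hV _ _).1 hx
    exact (hV _ _).2 ⟨by simpa using hx'.1, by rw [hσ_val _ hx'.1, hx'.2]⟩
  have vget : ∀ n, ∃ x, V x n := by
    intro n
    obtain ⟨x, hx⟩ := hv_surj n
    exact ⟨x, (hV _ _).2 hx⟩
  have vfix : ∀ m, ∃ x, σ x = x ∧ V x (4 * m) := by
    intro n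
    obtain ⟨x, hx, h, h'⟩ := hfix_onto n
    exact ⟨x, h, (hV _ _).2 ⟨hx, h'⟩⟩
  have hgain : ∀ (τ : K →+* K) (b : ℤ), (∀ c, σ c = c → τ c = c) →
      (∀ x n, V x n → V (τ x) n) → (∀ p, V p 1 → V (τ p - p) (b + 1)) →
      ∀ x n, V x n → Odd n → V (τ x - x) (n + b) := by
    intro τ b hf hp hr x n hx hn
    have h4 : (∃ k, n = 4 * k + 1) ∨ (∃ k, n = 4 * k - 1) := by
      obtain ⟨j, hj⟩ := hn
      rcases Int.even_or_odd' j with ⟨k, hk | hk⟩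
      · left; exact ⟨k, by omega⟩
      · right; exact ⟨k + 1, by omega⟩
    rcases h4 with ⟨k, hk⟩ | ⟨k, hk⟩
    · obtain ⟨c, hc, hcV⟩ := vfix k
      have hp1 : V (x / c) 1 := by
        have := vdiv hx hcV
        rwa [show n - 4 * k = 1 by omega] at this
      have h := vmul hcV (hr _ hp1)
      have hc0 := hne hcV
      rw [map_div₀, hf c hc, show c * (τ x / c - x / c) = τ x - x by field_simp] at h
      rwa [show n + b = 4 * k + (b + 1) by omega]
    · obtain ⟨c, hc, hcV⟩ := vfix k
      have hp1 : V (c / x) 1 := by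
        have := vdiv hcV hx
        rwa [show 4 * k - n = 1 by omega] at this
      have h := vdiv (vmul (vmul (vneg (hr _ hp1)) hx) (hp _ _ hx)) hcV
      have hc0 := hne hcV
      have hx0 := hne hx
      have htx0 := hne (hp _ _ hx)
      rw [map_div₀, hf c hc,
        show -(c / τ x - c / x) * x * τ x / c = τ x - x by field_simp; ring] at h
      rwa [show n + b = b + 1 + n + n - 4 * k by omega]
  have g1 : ∀ x n, V x n → Odd n → V (σ x - x) (n + b₁) := by
    refine hgain (σ : K →+* K) b₁ (fun c hc => hc) (fun x n h => vsig h) ?_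
    intro p hp
    exact (hV _ _).2 (hb_ram p (hne hp) (hval hp)).1
  have g2 : ∀ x n, V x n → Odd n → V (σ (σ x) - x) (n + b₂) := by
    refine hgain ((σ : K →+* K).comp (σ : K →+* K)) b₂ ?_ (fun x n h => vsig (vsig h)) ?_
    · intro c hc
      simp [hc]
    · intro p hp
      exact (hV _ _).2 (hb_ram p (hne hp) (hval hp)).2
  obtain ⟨p, hp⟩ := vget 1
  have hb1pos : 0 < b₁ := by
    have h := (hV _ _).1 (g1 p 1 hp odd_one)
    have h2 := hv_add (σ p) (-p) (hne (vsig hp)) (hne (vneg hp))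
      (by rw [← sub_eq_add_neg]; exact h.1)
    rw [← sub_eq_add_neg, h.2, hval (vsig hp), hval (vneg hp)] at h2
    obtain ⟨j, hj⟩ := hb₁_odd
    simp at h2
    omega
  have hspos : 0 < s := by omega
  -- final assembly
  suffices H : ∃ α t : K, V α b₂ ∧ σ t = t ∧ V t (4 * s) ∧
      V ((σ α + α) + (σ (σ (σ α) + α) + (σ (σ α) + α)) / t) (2 * b₂ - b₁) by
    obtain ⟨α, t, hα, ht, htV, hρ⟩ := H
    choose k hk hkV using vfix
    have ht0 := hne htV
    have hzp : ∀ n : ℤ, V (t ^ n) (4 * s * n) := by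
      have hnat : ∀ n : ℕ, V (t ^ n) (4 * s * n) := by
        intro n
        induction n with
        | zero => simpa using V1
        | succ n ih =>
          rw [pow_succ]
          have := vmul ih htV
          rwa [show 4 * s * (n : ℤ) + 4 * s = 4 * s * ((n + 1 : ℕ) : ℤ) by push_cast; ring] at this
      intro n
      obtain ⟨j, rfl | rfl⟩ := n.eq_nat_or_neg
      · simpa using hnat j
      · have := vinv (hnat j)
        rw [zpow_neg, zpow_natCast]
        rwa [show 4 * s * -(j : ℤ) = -(4 * s * (j : ℤ)) by ring]
    obtain ⟨c, hc⟩ : ∃ c : ℤ → K, ∀ m, c m = t ^ (m / s) * k (m % s) := ⟨_, fun _ => rfl⟩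
    have hcV : ∀ m, V (c m) (4 * m) := by
      intro m
      rw [hc]
      have := vmul (hzp (m / s)) (hkV (m % s))
      rwa [show 4 * s * (m / s) + 4 * (m % s) = 4 * m by
        linear_combination 4 * Int.mul_ediv_add_emod m s] at this
    have hcs : ∀ m, σ (c m) = c m := by
      intro m
      rw [hc, map_mul, map_zpow₀, ht, hk]
    have hcm : ∀ m, c (m - s) = c m / t := by
      intro m
      rw [hc, hc, Int.sub_emod_right, Int.sub_ediv_of_dvd _ (dvd_refl s),
        Int.ediv_self (ne_of_gt hspos), zpow_sub_one₀ ht0]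
      field_simp
    have key : ∀ m, V ((σ (c m * α) + c m * α) +
            (σ (σ (σ (c (m - s) * α)) + c (m - s) * α) + (σ (σ (c (m - s) * α)) + c (m - s) * α)))
          (2 * b₂ - b₁ + 4 * m) := by
      intro m
      have h := vmul hρ (hcV m)
      convert h using 1
      rw [hcm]
      simp only [map_mul, map_add, map_div₀, hcs, ht]
      field_simp
    refine ⟨fun m => c m * α, fun m => ?_, fun m => ?_⟩
    · have h := vmul (hcV m) hα
      exact ⟨hne h, by rw [hval h]; ring⟩
    · have h := key m
      exact ⟨hne h, hval h, fun h3 => by rw [hval h]; omega⟩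
  by_cases h2 : (2 : K) = 0
  · -- characteristic two
    have hadd : ∀ x : K, x + x = 0 := fun x => by linear_combination x * h2
    have hsub : ∀ x y : K, x - y = x + y := fun x y => by linear_combination (-y) * h2
    obtain ⟨x0, hx0⟩ := vget (-b₂)
    have hE := g2 x0 _ hx0 hb₂_odd.neg
    obtain ⟨E, hEd⟩ : ∃ E, E = σ (σ x0) - x0 := ⟨_, rfl⟩
    rw [← hEd, neg_add_cancel] at hE
    have hE0 := hne hE
    have hEs : σ (σ E) = E := by
      rw [hEd, map_sub, map_sub, hs4, hsub, hsub, add_comm]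
    obtain ⟨x, hxd⟩ : ∃ x, x = x0 / E := ⟨_, rfl⟩
    have hx : V x (-b₂) := by
      have := vdiv hx0 hE
      rwa [sub_zero, ← hxd] at this
    have hx2 : σ (σ x) = x + 1 := by
      rw [hxd, map_div₀, map_div₀, hEs]
      field_simp
      rw [hEd]; ring
    obtain ⟨η, hηd⟩ : ∃ η, η = σ x - x := ⟨_, rfl⟩
    have hη : V η (-b₂ + b₁) := hηd ▸ g1 x _ hx hb₂_odd.neg
    have hsx : σ x = x + η := by rw [hηd]; ring
    have hση : σ η = η + 1 := by
      have : σ (σ x) = σ x + σ η := by rw [← map_add, ← hsx]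
      rw [hx2, hsx] at this
      linear_combination -this + (-η) * h2
    have hb : b₂ = 3 * b₁ := by
      obtain ⟨ε, hεd⟩ : ∃ ε, ε = σ p / p - 1 := ⟨_, rfl⟩
      have hp0 := hne hp
      have hε : V ε b₁ := by
        have := vdiv (g1 p _ hp odd_one) hp
        rwa [sub_div, div_self hp0, ← hεd, add_sub_cancel_left] at this
      have hsp : σ p = p * (1 + ε) := by rw [hεd]; field_simp; ring
      obtain ⟨N, hNd⟩ : ∃ N, N = p * σ (σ p) := ⟨_, rfl⟩
      have hN : V N (1 + 1) := hNd ▸ vmul hp (vsig (vsig hp))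
      have hN2 : σ (σ N) = N := by rw [hNd, map_mul, map_mul, hs4, mul_comm]
      have hq : V (σ N - N) (2 + 2 * b₁) := by
        have e : σ N - N = N * (ε * σ (σ ε) + (σ (σ ε) - ε)) := by
          have e1 : σ (σ (σ p)) = σ (σ p) * (1 + σ (σ ε)) := by
            conv_lhs => rw [hsp]
            simp
          rw [hNd, map_mul, e1, hsp]
          linear_combination (p * ε * σ (p * (1 + ε))) * h2
        rw [e]
        have h3 := vadd (vmul hε (vsig (vsig hε))) (g2 ε _ hε hb₁_odd) (by omega)
        have h4 := vmul hN h3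
        rwa [show 1 + 1 + (b₁ + b₁) = 2 + 2 * b₁ by ring] at h4
      obtain ⟨q, hqd⟩ : ∃ q, q = σ N - N := ⟨_, rfl⟩
      rw [← hqd] at hq
      have hsq : σ q = q := by
        rw [hqd, map_sub, hN2]
        linear_combination (N - σ N) * h2
      have hsN : σ N = N + q := by rw [hqd]; ring
      have hqη := vneg (vmul hq hη)
      have hfx : σ (N + -(q * η)) = N + -(q * η) := by
        rw [map_add, map_neg, map_mul, hsN, hsq, hση]; ring
      by_contra hcon
      obtain ⟨j, hj⟩ := hb₁_odd
      rcases lt_trichotomy (1 + 1) (2 + 2 * b₁ + (-b₂ + b₁)) with h | h | h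
      · have h5 := vadd hN hqη h
        have h6 := hfix_val _ (hne h5) hfx
        rw [hval h5] at h6
        omega
      · omega
      · have h5 := vadd' hN hqη h
        have h6 := hfix_val _ (hne h5) hfx
        rw [hval h5] at h6
        omega
    obtain ⟨c, hc, hcV⟩ := vfix (2 * b₁)
    have hc0 := hne hcV
    have hη0 := hne hη
    have hη1 : V (η + 1) (-b₂ + b₁) := hση ▸ vsig hη
    have hη10 := hne hη1
    have hsη1 : σ (η + 1) = η := by
      rw [map_add, map_one, hση]; linear_combination h2
    have haV := vmul (vmul hcV hη) hη1
    refine ⟨c * η * x, c / (c * η * (η + 1)), ?_, ?_, ?_, ?_⟩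
    · have := vmul (vmul hcV hη) hx
      rwa [show 4 * (2 * b₁) + (-b₂ + b₁) + -b₂ = b₂ by omega] at this
    · rw [map_div₀, map_mul, map_mul, hc, hsη1, hση]
      ring
    · have := vdiv hcV haV
      rwa [show 4 * (2 * b₁) - (4 * (2 * b₁) + (-b₂ + b₁) + (-b₂ + b₁)) = 4 * s by omega] at this
    · have h := vmul hcV hx
      rw [show 4 * (2 * b₁) + -b₂ = 2 * b₂ - b₁ by omega] at h
      convert h using 1
      have e1 : σ (c * η * x) + c * η * x = c * x + c * η * (η + 1) := by
        rw [map_mul, map_mul, hc, hση, hsx]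
        linear_combination (c * η * x) * h2
      have e2 : σ (σ (c * η * x)) + c * η * x = c * η := by
        simp only [map_mul, hc, hση, map_add, map_one, hx2]
        linear_combination (c * η * x + c * x + c) * h2
      have e3 : σ (c * η) + c * η = c := by
        rw [map_mul, hc, hση]
        linear_combination (c * η) * h2
      rw [e2, e1, e3]
      field_simp
      linear_combination (η * (η + 1)) * h2
  · -- the main case
    have V2 : V 2 (4 * e₀) := (hV _ _).2 ⟨h2, hv_two⟩
    have hlt : b₂ < 4 * e₀ := by omega
    obtain ⟨x, hx⟩ := vget (-b₂)
    have hD := g2 x _ hx hb₂_odd.neg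
    rw [neg_add_cancel] at hD
    have hE : V (σ (σ x) + x) 0 := by
      have := vadd hD (vmul V2 hx) (by omega)
      rwa [show σ (σ x) - x + 2 * x = σ (σ x) + x by ring] at this
    have hE0 := hne hE
    obtain ⟨δ, hδd⟩ : ∃ δ, δ = (σ (σ x) - x) / (σ (σ x) + x) := ⟨_, rfl⟩
    have hδ : V δ 0 := by
      have := vdiv hD hE
      rwa [← hδd, sub_zero] at this
    have hδ0 := hne hδ
    have hδ2 : σ (σ δ) = -δ := by
      rw [hδd]
      simp only [map_div₀, map_sub, map_add, hs4]
      rw [add_comm x, ← neg_div, neg_sub]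
    have hδ1 : V (δ - 1) (4 * e₀ - b₂) := by
      have := vdiv (vneg (vmul V2 hx)) hE
      rw [show -(2 * x) / (σ (σ x) + x) = δ - 1 by rw [hδd]; field_simp; ring] at this
      rwa [show 4 * e₀ + -b₂ - 0 = 4 * e₀ - b₂ by ring] at this
    have hdodd : Odd (4 * e₀ - b₂) := by
      obtain ⟨j, hj⟩ := hb₂_odd
      exact ⟨2 * e₀ - j - 1, by omega⟩
    obtain ⟨θ, hθd⟩ : ∃ θ, θ = σ δ / δ := ⟨_, rfl⟩
    have hsδ : σ δ = θ * δ := by rw [hθd]; field_simp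
    have hθ : V θ 0 := by
      have := vdiv (vsig hδ) hδ
      rwa [← hθd, sub_zero] at this
    have hθ0 := hne hθ
    have hsθ : σ θ = -θ⁻¹ := by
      rw [hθd, map_div₀, hδ2, inv_div, neg_div]
    have hθ1 : V (θ + 1) (4 * e₀ - b₂ + b₁) := by
      have := vdiv (vadd (g1 _ _ hδ1 hdodd) (vmul V2 hδ) (by omega)) hδ
      rw [map_sub, map_one, hsδ] at this
      rw [show (θ * δ - 1 - (δ - 1) + 2 * δ) / δ = θ + 1 by field_simp; ring] at this
      rwa [sub_zero] at this
    obtain ⟨c, hc, hcV⟩ := vfix (3 * s - b₁ - 2 * e₀)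
    have hc0 := hne hcV
    obtain ⟨α, hαd⟩ : ∃ α, α = c * (θ + 1) * (δ - 1) := ⟨_, rfl⟩
    have hα : V α b₂ := by
      have := vmul (vmul hcV hθ1) hδ1
      rwa [← hαd, show 4 * (3 * s - b₁ - 2 * e₀) + (4 * e₀ - b₂ + b₁) + (4 * e₀ - b₂) = b₂ by
        omega] at this
    have hA : V (σ α + α) (b₁ + b₂) := by
      have := vadd (g1 _ _ hα hb₂_odd) (vmul V2 hα) (by omega)
      rwa [show σ α - α + 2 * α = σ α + α by ring, add_comm b₂] at this
    obtain ⟨a, had⟩ : ∃ a, a = 2 * c - c * (σ θ + θ + 2) := ⟨_, rfl⟩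
    have hAa : σ α + α - a = 2 * c * (σ δ - 1) := by
      rw [had, hαd, map_mul, map_mul, map_add, map_sub, map_one, hc, hsδ, hsθ]
      field_simp
      ring
    have hAaV : V (σ α + α - a) (2 * b₂ - b₁) := by
      have := vmul (vmul V2 hcV) (vsig hδ1)
      rw [map_sub, map_one] at this
      rwa [hAa, show 2 * b₂ - b₁ = 4 * e₀ + 4 * (3 * s - b₁ - 2 * e₀) + (4 * e₀ - b₂) by omega]
    have haV : V a (b₁ + b₂) := by
      have := vadd hA (vneg hAaV) (by omega)
      rwa [show σ α + α + -(σ α + α - a) = a by ring] at this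
    have ha0 := hne haV
    have hθ2 : σ (σ θ) = θ := by
      rw [hsθ, map_neg, map_inv₀, hsθ]; simp
    have hsa : σ a = a := by
      rw [had]
      simp only [map_sub, map_mul, map_add, hc, hθ2, map_ofNat]
      ring
    obtain ⟨T, hTd⟩ : ∃ T, T = σ (σ (σ α) + α) + (σ (σ α) + α) := ⟨_, rfl⟩
    have e1 : σ (σ α) + α = -(2 * c * (θ + 1)) := by
      rw [hαd]
      simp only [map_sub, map_mul, map_add, hc, hθ2, hδ2, map_one]
      ring
    have hT1 : T = -(2 * c * (σ θ + θ + 2)) := by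
      rw [hTd, e1]
      simp only [map_mul, map_add, map_neg, hc, map_one, map_ofNat]
      ring
    have hsT : σ T = T := by
      rw [hT1]
      simp only [map_mul, map_add, map_neg, hc, hθ2, map_ofNat]
      ring
    have hT2 : T = -(2 * c * ((θ + 1) * (θ + 1) + -2)) / θ := by
      rw [hT1, hsθ]
      field_simp
      ring
    have hTV : V T (8 * s) := by
      rw [hT2]
      rcases hcase with h | h
      · have h5 := vadd' (vmul hθ1 hθ1) (vneg V2) (by omega)
        have h6 := vdiv (vneg (vmul (vmul V2 hcV) h5)) hθ
        rwa [show 4 * e₀ + 4 * (3 * s - b₁ - 2 * e₀) + 4 * e₀ - 0 = 8 * s by omega] at h6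
      · have h5 := vadd (vmul hθ1 hθ1) (vneg V2) (by omega)
        have h6 := vdiv (vneg (vmul (vmul V2 hcV) h5)) hθ
        rwa [show 4 * e₀ + 4 * (3 * s - b₁ - 2 * e₀) +
          (4 * e₀ - b₂ + b₁ + (4 * e₀ - b₂ + b₁)) - 0 = 8 * s by omega] at h6
    have hT0 := hne hTV
    refine ⟨α, -T / a, hα, ?_, ?_, ?_⟩
    · rw [map_div₀, map_neg, hsT, hsa]
    · have := vdiv (vneg hTV) haV
      rwa [show 8 * s - (b₁ + b₂) = 4 * s by omega] at this
    · rw [← hTd]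
      convert hAaV using 1
      field_simp
      ring
end

section
/- Assume b_1 and b_2 are odd, b_1 < e_0, and b_2 = 4e_0 − b_1. Then there exists a family of elements α_m ∈ K_2 (indexed by m ∈ ℤ) with v_2(α_m) = b_2 + 4m, such that for every m the element ρ_m = (σ+1)α_m − (1/2)(σ+1)(σ²+1)α_m + (1/2)(σ+1)(σ²+1)α_{m+e_0−b_1} (where (σ+1)x denotes σ(x) + x and (σ²+1)x denotes σ²(x) + x) satisfies v_2(ρ_m) = 2b_2 − b_1 + 4m. -/
section HelperLemmas
variable {K : Type*} [Field K] {v : K → ℤ}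

/-- `x` is nonzero of valuation `n`. -/
def HasVal (v : K → ℤ) (x : K) (n : ℤ) : Prop := x ≠ 0 ∧ v x = n

theorem HasVal.mul (hm : ∀ x y : K, x ≠ 0 → y ≠ 0 → v (x * y) = v x + v y)
    {x y : K} {a b : ℤ} (hx : HasVal v x a) (hy : HasVal v y b) : HasVal v (x * y) (a + b) :=
  ⟨mul_ne_zero hx.1 hy.1, by rw [hm x y hx.1 hy.1, hx.2, hy.2]⟩

theorem hasVal_one (hm : ∀ x y : K, x ≠ 0 → y ≠ 0 → v (x * y) = v x + v y) :
    HasVal v (1 : K) 0 := by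
  refine ⟨one_ne_zero, ?_⟩
  have := hm 1 1 one_ne_zero one_ne_zero
  rw [mul_one] at this
  omega

theorem HasVal.inv (hm : ∀ x y : K, x ≠ 0 → y ≠ 0 → v (x * y) = v x + v y)
    {x : K} {a : ℤ} (hx : HasVal v x a) : HasVal v x⁻¹ (-a) := by
  refine ⟨inv_ne_zero hx.1, ?_⟩
  have := hm x x⁻¹ hx.1 (inv_ne_zero hx.1)
  rw [mul_inv_cancel₀ hx.1, (hasVal_one hm).2, hx.2] at this
  omega

theorem HasVal.div (hm : ∀ x y : K, x ≠ 0 → y ≠ 0 → v (x * y) = v x + v y)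
    {x y : K} {a b : ℤ} (hx : HasVal v x a) (hy : HasVal v y b) : HasVal v (x / y) (a - b) := by
  rw [div_eq_mul_inv, sub_eq_add_neg]
  exact hx.mul hm (hy.inv hm)

theorem HasVal.neg (hm : ∀ x y : K, x ≠ 0 → y ≠ 0 → v (x * y) = v x + v y)
    {x : K} {a : ℤ} (hx : HasVal v x a) : HasVal v (-x) a := by
  have h0 : (-1 : K) ≠ 0 := neg_ne_zero.mpr one_ne_zero
  have := hm (-1) (-1) h0 h0
  rw [neg_mul_neg, mul_one, (hasVal_one hm).2] at this
  have h1 : HasVal v (-1 : K) 0 := ⟨h0, by omega⟩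
  have h2 := h1.mul hm hx
  rwa [neg_one_mul, zero_add] at h2

theorem HasVal.add (hm : ∀ x y : K, x ≠ 0 → y ≠ 0 → v (x * y) = v x + v y)
    (ha : ∀ x y : K, x ≠ 0 → y ≠ 0 → x + y ≠ 0 → min (v x) (v y) ≤ v (x + y))
    {x y : K} {a : ℤ} (hx : HasVal v x a) (hy : y = 0 ∨ a < v y) : HasVal v (x + y) a := by
  by_cases hy0 : y = 0
  · rw [hy0, add_zero]; exact hx
  have hlt : a < v y := hy.resolve_left hy0
  have hny : HasVal v (-y) (v y) := HasVal.neg hm ⟨hy0, rfl⟩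
  have hne : x + y ≠ 0 := by
    intro h
    have hxy : x = -y := eq_neg_of_add_eq_zero_left h
    have h1 := hx.2
    rw [hxy, hny.2] at h1
    omega
  refine ⟨hne, ?_⟩
  have h1 := ha x y hx.1 hy0 hne
  have h2 := ha (x + y) (-y) hne hny.1 (by rw [add_neg_cancel_right]; exact hx.1)
  rw [add_neg_cancel_right, hny.2, hx.2] at h2
  rw [hx.2] at h1
  omega

theorem lt_val_add
    (ha : ∀ x y : K, x ≠ 0 → y ≠ 0 → x + y ≠ 0 → min (v x) (v y) ≤ v (x + y))
    {x y : K} {a : ℤ} (hx : x = 0 ∨ a < v x) (hy : y = 0 ∨ a < v y) :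
    x + y = 0 ∨ a < v (x + y) := by
  by_cases hx0 : x = 0
  · rw [hx0, zero_add]; exact hy
  by_cases hy0 : y = 0
  · rw [hy0, add_zero]; exact hx
  by_cases h : x + y = 0
  · exact Or.inl h
  right
  have h1 := ha x y hx0 hy0 h
  have h2 := hx.resolve_left hx0
  have h3 := hy.resolve_left hy0
  omega

/-- An automorphism with break `b` shifts odd valuations by exactly `b`. -/
theorem odd_shift (hm : ∀ x y : K, x ≠ 0 → y ≠ 0 → v (x * y) = v x + v y)
    (τ : K ≃+* K) (b : ℤ) (hval : ∀ x : K, x ≠ 0 → v (τ x) = v x)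
    (hfix : ∀ m : ℤ, ∃ x : K, x ≠ 0 ∧ τ x = x ∧ v x = 4 * m)
    (hram : ∀ π : K, π ≠ 0 → v π = 1 → τ π - π ≠ 0 ∧ v (τ π - π) = b + 1)
    {x : K} {n : ℤ} (hx : HasVal v x n) (hn : Odd n) : HasVal v (τ x - x) (n + b) := by
  obtain ⟨j, hj⟩ := hn
  rcases Int.even_or_odd j with ⟨m, hm'⟩ | ⟨m, hm'⟩
  · obtain ⟨k, hk0, hkf, hkv⟩ := hfix m
    have hk : HasVal v k (4 * m) := ⟨hk0, hkv⟩
    have hp := hx.div hm hk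
    have hr : HasVal v (τ (x / k) - x / k) (b + 1) := hram _ hp.1 (by rw [hp.2]; omega)
    have h := hk.mul hm hr
    have e : k * (τ (x / k) - x / k) = τ x - x := by
      rw [map_div₀, hkf]; field_simp
    rw [e] at h
    exact ⟨h.1, by rw [h.2]; omega⟩
  · obtain ⟨k, hk0, hkf, hkv⟩ := hfix (m + 1)
    have hk : HasVal v k (4 * (m + 1)) := ⟨hk0, hkv⟩
    have hp := hk.div hm hx
    have hr : HasVal v (τ (k / x) - k / x) (b + 1) := hram _ hp.1 (by rw [hp.2]; omega)
    have hτx0 : τ x ≠ 0 := (map_ne_zero τ).mpr hx.1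
    have hτx : HasVal v (τ x) n := ⟨hτx0, by rw [hval x hx.1, hx.2]⟩
    have h := (((hr.mul hm hx).mul hm hτx).div hm hk).neg hm
    have hx0 := hx.1
    have e : -((τ (k / x) - k / x) * x * τ x / k) = τ x - x := by
      rw [map_div₀, hkf]; field_simp; ring
    rw [e] at h
    exact ⟨h.1, by rw [h.2]; omega⟩

end HelperLemmas


/-- **Lemma 3.4.**  Let `K₂/K₀` be a totally ramified cyclic quartic
extension of `2`-adic fields with odd ramification break numbers `b₁ < b₂`, `b₁ < e₀`,
and `b₂ = 4 e₀ - b₁`.  There is a family `α_m ∈ K₂` with `v (α_m) = b₂ + 4 m` such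
that `ρ_m = (σ+1) α_m - (1/2)(σ+1)(σ²+1) α_m + (1/2)(σ+1)(σ²+1) α_{m+e₀-b₁}` has
`v (ρ_m) = 2 b₂ - b₁ + 4 m`. -/
theorem stmt_11
    (K : Type*) [Field K] (σ : K ≃+* K) (v : K → ℤ) (e₀ b₁ b₂ : ℤ)
    -- `v` is the normalized additive valuation of `K = K₂`, surjective onto `ℤ`
    (hv_mul : ∀ x y : K, x ≠ 0 → y ≠ 0 → v (x * y) = v x + v y)
    (hv_add : ∀ x y : K, x ≠ 0 → y ≠ 0 → x + y ≠ 0 → min (v x) (v y) ≤ v (x + y))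
    (hv_surj : ∀ n : ℤ, ∃ x : K, x ≠ 0 ∧ v x = n)
    -- `K` is complete with respect to `v` (it is a finite extension of `ℚ₂`)
    (hv_complete : ∀ f : ℕ → K,
      (∀ m : ℕ, f (m + 1) - f m = 0 ∨ (m : ℤ) ≤ v (f (m + 1) - f m)) →
      ∃ x : K, ∀ m : ℕ, x - f m = 0 ∨ (m : ℤ) ≤ v (x - f m))
    -- `σ` generates the cyclic Galois group of order `4` of `K₂/K₀`;
    -- `σ` preserves the valuation.  (The fixed field of `σ ^ 2` is `K₁`.)
    (hσ_order : σ ^ 4 = 1) (hσ_ne : σ ^ 2 ≠ 1)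
    (hσ_val : ∀ x : K, x ≠ 0 → v (σ x) = v x)
    -- `K₂/K₀` is totally ramified of degree `4`:  `v (K₀ˣ) = 4ℤ`,
    -- where `K₀` is the fixed field of `σ`
    (hfix_val : ∀ x : K, x ≠ 0 → σ x = x → 4 ∣ v x)
    (hfix_onto : ∀ m : ℤ, ∃ x : K, x ≠ 0 ∧ σ x = x ∧ v x = 4 * m)
    -- the absolute ramification index of `K₀` is `e₀`, so `v 2 = 4 e₀`
    (hv_two : v (2 : K) = 4 * e₀)
    -- `b₁ < b₂` are the ramification break numbers of `K₂/K₀`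
    (hb_lt : b₁ < b₂)
    (hb_ram : ∀ π : K, π ≠ 0 → v π = 1 →
      (σ π - π ≠ 0 ∧ v (σ π - π) = b₁ + 1) ∧
      ((σ ^ 2) π - π ≠ 0 ∧ v ((σ ^ 2) π - π) = b₂ + 1))
    (hb₁_odd : Odd b₁) (hb₂_odd : Odd b₂) (hb₁_lt : b₁ < e₀)
    (hcase : b₂ = 4 * e₀ - b₁) :
    ∃ α : ℤ → K,
      (∀ m : ℤ, α m ≠ 0 ∧ v (α m) = b₂ + 4 * m) ∧
      (∀ m : ℤ,
        (σ (α m) + α m) -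
            (2 : K)⁻¹ * (σ ((σ ^ 2) (α m) + α m) + ((σ ^ 2) (α m) + α m)) +
            (2 : K)⁻¹ * (σ ((σ ^ 2) (α (m + e₀ - b₁)) + α (m + e₀ - b₁)) +
              ((σ ^ 2) (α (m + e₀ - b₁)) + α (m + e₀ - b₁))) ≠ 0 ∧
        v ((σ (α m) + α m) -
            (2 : K)⁻¹ * (σ ((σ ^ 2) (α m) + α m) + ((σ ^ 2) (α m) + α m)) +
            (2 : K)⁻¹ * (σ ((σ ^ 2) (α (m + e₀ - b₁)) + α (m + e₀ - b₁)) +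
              ((σ ^ 2) (α (m + e₀ - b₁)) + α (m + e₀ - b₁)))) =
          2 * b₂ - b₁ + 4 * m) := by
  have hs4 : ∀ x, σ (σ (σ (σ x))) = x := fun x => by
    have := congrArg (fun f : K ≃+* K => f x) hσ_order
    simpa [pow_succ] using this
  have hs2 : ∀ x, (σ ^ 2) x = σ (σ x) := fun x => by simp [pow_succ]
  have hσ : ∀ {x : K} {n : ℤ}, HasVal v x n → HasVal v (σ x) n := fun {x n} hx =>
    ⟨(map_ne_zero σ).mpr hx.1, by rw [hσ_val x hx.1, hx.2]⟩
  have odd1 : ∀ {x : K} {n : ℤ}, HasVal v x n → Odd n → HasVal v (σ x - x) (n + b₁) :=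
    fun {x n} hx hn => odd_shift hv_mul σ b₁ hσ_val hfix_onto
      (fun π h0 h1 => (hb_ram π h0 h1).1) hx hn
  have odd2 : ∀ {x : K} {n : ℤ}, HasVal v x n → Odd n → HasVal v (σ (σ x) - x) (n + b₂) :=
    fun {x n} hx hn => by
      have := odd_shift hv_mul (σ ^ 2) b₂
        (fun x h => by rw [hs2, hσ_val _ ((map_ne_zero σ).mpr h), hσ_val x h])
        (fun m => by
          obtain ⟨k, h0, h1, h2⟩ := hfix_onto m
          exact ⟨k, h0, by rw [hs2, h1, h1], h2⟩)
        (fun π h0 h1 => (hb_ram π h0 h1).2) hx hn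
      rwa [hs2] at this
  have htwo : ∀ {x : K} {n : ℤ}, HasVal v x n → 2 * x = 0 ∨ v (2 * x) = 4 * e₀ + n :=
    fun {x n} hx => by
      by_cases h2 : (2 : K) = 0
      · left; rw [h2, zero_mul]
      · right; rw [hv_mul _ _ h2 hx.1, hv_two, hx.2]
  obtain ⟨π, hπ0, hπ1⟩ := hv_surj 1
  have hπ : HasVal v π 1 := ⟨hπ0, hπ1⟩
  have ha : HasVal v (σ π - π) (1 + b₁) := odd1 hπ odd_one
  have hb₁pos : 1 ≤ b₁ := by
    have h1 := hv_add (σ π) (-π) (hσ hπ).1 (hπ.neg hv_mul).1 (by rw [← sub_eq_add_neg]; exact ha.1)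
    rw [← sub_eq_add_neg, ha.2, (hσ hπ).2, (hπ.neg hv_mul).2] at h1
    obtain ⟨j, hj⟩ := hb₁_odd
    omega
  -- the element `N` of `K₁` of valuation `2`
  obtain ⟨N, hNdef⟩ : ∃ N, N = π * σ (σ π) := ⟨_, rfl⟩
  have hN : HasVal v N 2 := by rw [hNdef]; exact hπ.mul hv_mul (hσ (hσ hπ))
  have hNf : σ (σ N) = N := by rw [hNdef, map_mul, map_mul, hs4]; ring
  have hNd : HasVal v (σ N - N) (2 + 2 * b₁) := by
    obtain ⟨ε, hεdef⟩ : ∃ ε, ε = (σ π - π) / π := ⟨_, rfl⟩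
    have hε : HasVal v ε b₁ := by
      have := ha.div hv_mul hπ
      rw [← hεdef] at this
      exact ⟨this.1, by rw [this.2]; omega⟩
    have h1 : HasVal v (ε * σ (σ ε)) (b₁ + b₁) := hε.mul hv_mul (hσ (hσ hε))
    have h2 : HasVal v (σ (σ ε) - ε) (b₁ + b₂) := odd2 hε hb₁_odd
    have h3 : HasVal v (ε * σ (σ ε) + ((σ (σ ε) - ε) + 2 * ε)) (b₁ + b₁) := by
      refine h1.add hv_mul hv_add (lt_val_add hv_add (Or.inr (by rw [h2.2]; omega)) ?_)
      rcases htwo hε with h | h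
      · exact Or.inl h
      · right; rw [h]; omega
    have h4 := hN.mul hv_mul h3
    have e1 : σ π = π * (1 + ε) := by rw [hεdef]; field_simp; ring
    have e : N * (ε * σ (σ ε) + ((σ (σ ε) - ε) + 2 * ε)) = σ N - N := by
      have e3 : σ (σ (σ π)) = σ (σ π) * (1 + σ (σ ε)) := by
        conv_lhs => rw [e1]
        simp only [map_mul, map_add, map_one]
      rw [hNdef, map_mul, e3, e1]
      ring
    rw [e] at h4
    exact ⟨h4.1, by rw [h4.2]; ring⟩
  have hσNd : σ (σ N - N) = -(σ N - N) := by rw [map_sub, hNf]; ring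
  have k1 : ∀ {w : K} {n : ℤ}, HasVal v w n → σ (σ w) = w → n % 4 = 2 →
      HasVal v (σ w - w) (n + 2 * b₁) := fun {w n} hw hwf hn => by
    obtain ⟨l, hl⟩ : ∃ l, l = (σ w - w) / (σ N - N) := ⟨_, rfl⟩
    have hNd0 := hNd.1
    have hlf : σ l = l := by
      rw [hl, map_div₀, hσNd, map_sub, hwf, div_neg, ← neg_div]; ring
    have hlN : σ w - w = l * (σ N - N) := by rw [hl]; field_simp
    have hkf : σ (w - l * N) = w - l * N := by
      rw [map_sub, map_mul, hlf]; linear_combination hlN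
    have hl0 : l ≠ 0 := by
      rintro rfl
      have := hfix_val _ hw.1 (by linear_combination hlN)
      rw [hw.2] at this
      omega
    have hlv := hfix_val l hl0 hlf
    have hL : HasVal v l (v l) := ⟨hl0, rfl⟩
    have hLN := hL.mul hv_mul hN
    have hval : v l + 2 = n := by
      by_cases hk0 : w - l * N = 0
      · rw [← hLN.2, ← hw.2, sub_eq_zero.mp hk0]
      · have hkv := hfix_val _ hk0 hkf
        have hK : HasVal v (w - l * N) (v (w - l * N)) := ⟨hk0, rfl⟩
        have e : w = l * N + (w - l * N) := by ring
        have e' : w = (w - l * N) + l * N := by ring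
        rcases lt_trichotomy (v l + 2) (v (w - l * N)) with h | h | h
        · have := hLN.add hv_mul hv_add (Or.inr h)
          rw [← e] at this
          rw [← this.2, hw.2]
        · omega
        · have := hK.add hv_mul hv_add (y := l * N) (Or.inr (by rw [hLN.2]; exact h))
          rw [← e'] at this
          have := this.2
          rw [hw.2] at this
          omega
    rw [hlN]
    have := hL.mul hv_mul hNd
    exact ⟨this.1, by rw [this.2]; omega⟩
  have tr2 : ∀ {x : K} {n : ℤ}, HasVal v x n → Odd n → HasVal v (σ (σ x) + x) (n + b₂) :=
    fun {x n} hx hn => by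
      have e : σ (σ x) + x = (σ (σ x) - x) + 2 * x := by ring
      rw [e]
      refine (odd2 hx hn).add hv_mul hv_add ?_
      rcases htwo hx with h | h
      · exact Or.inl h
      · right; rw [h]; omega
  have mod1 : b₁ % 4 = 1 ∧ b₂ % 4 = 3 ∨ b₁ % 4 = 3 ∧ b₂ % 4 = 1 := by
    obtain ⟨j, hj⟩ := hb₁_odd
    omega
  -- an element of odd valuation with relative trace a prescribed element of `K₀`
  have getρ : ∀ (c : K) (n : ℤ), HasVal v c n → σ c = c → n % 4 = 0 →
      ∃ ρ, HasVal v ρ (n - b₂) ∧ σ (σ ρ) + ρ = c := fun c n hc hcf hn => by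
    have ht := tr2 hπ odd_one
    have ht0 := ht.1
    refine ⟨π * (c / (σ (σ π) + π)), ?_, ?_⟩
    · have := hπ.mul hv_mul (hc.div hv_mul ht)
      exact ⟨this.1, by rw [this.2]; ring⟩
    · simp only [map_mul, map_div₀, map_add, hs4, hcf]
      rw [add_comm π (σ (σ π))]
      field_simp
  -- characteristic two is impossible
  have h20 : (2 : K) ≠ 0 := by
    intro h2
    obtain ⟨c, hc0, hcf, hcv⟩ := hfix_onto 0
    obtain ⟨ρ, hρ, hρt⟩ := getρ c (4 * 0) ⟨hc0, hcv⟩ hcf (by norm_num)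
    have hβ := odd1 hρ (by obtain ⟨j, hj⟩ := hb₂_odd; exact ⟨-j - 1, by omega⟩)
    have e1 : σ (σ ρ - ρ) - (σ ρ - ρ) = c := by
      rw [map_sub, ← hρt]; linear_combination (-σ ρ) * h2
    have e2 : σ (σ (σ ρ - ρ)) = σ ρ - ρ := by
      have e3 := congrArg σ e1
      rw [hcf, map_sub] at e3
      linear_combination e3 + e1 + (σ (σ ρ - ρ) - (σ ρ - ρ)) * h2 - (σ (σ ρ - ρ) - (σ ρ - ρ) - c) * h2 - (σ ρ - ρ) * h2 + (σ ρ - ρ) * h2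
    have h := k1 hβ e2 (by omega)
    rw [e1] at h
    have := h.2
    rw [hcv] at this
    omega
  have hv2 : HasVal v (2 : K) (4 * e₀) := ⟨h20, hv_two⟩
  obtain ⟨c₀, hc0, hcf, hcv⟩ := hfix_onto (2 * e₀ - b₁)
  have hc : HasVal v c₀ (4 * (2 * e₀ - b₁)) := ⟨hc0, hcv⟩
  have hσ2 : σ (2 : K) = 2 := map_ofNat σ 2
  obtain ⟨ρ, hρ, hρt⟩ := getρ (2 * c₀) _ (hv2.mul hv_mul hc) (by rw [map_mul, hcf, hσ2]) (by omega)
  have hβ : HasVal v (σ ρ - ρ) (2 * b₂) := by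
    have := odd1 hρ (by obtain ⟨j, hj⟩ := hb₂_odd; exact ⟨6 * e₀ - 2 * b₁ - j - 1, by omega⟩)
    exact ⟨this.1, by rw [this.2]; omega⟩
  have hβσ : σ (σ (σ ρ - ρ)) = -(σ ρ - ρ) := by
    have h1 := congrArg σ hρt
    rw [map_add, map_mul, hcf, hσ2] at h1
    simp only [map_sub]
    linear_combination h1 - hρt
  obtain ⟨x, hx0, hxv⟩ := hv_surj b₂
  have hx : HasVal v x b₂ := ⟨hx0, hxv⟩
  have hδ := odd2 hx hb₂_odd
  obtain ⟨α, hαdef⟩ : ∃ α, α = x * ((σ ρ - ρ) / (σ (σ x) - x)) := ⟨_, rfl⟩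
  have hα : HasVal v α b₂ := by
    have := hx.mul hv_mul (hβ.div hv_mul hδ)
    rw [← hαdef] at this
    exact ⟨this.1, by rw [this.2]; ring⟩
  have hαβ : σ (σ α) - α = σ ρ - ρ := by
    have hδ0 := hδ.1
    have e : σ (σ ((σ ρ - ρ) / (σ (σ x) - x))) = (σ ρ - ρ) / (σ (σ x) - x) := by
      rw [map_div₀, map_div₀, hβσ, map_sub σ (σ (σ x)), map_sub σ (σ (σ (σ x))), hs4,
        ← neg_sub (σ (σ x)) x, neg_div_neg_eq]
    rw [hαdef, map_mul, map_mul, e]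
    field_simp
  have hT := tr2 hα hb₂_odd
  have hTf : σ (σ (σ (σ α) + α)) = σ (σ α) + α := by
    rw [map_add, map_add, hs4, add_comm]
  have hTr : HasVal v (σ (σ (σ α) + α) + (σ (σ α) + α)) (8 * e₀) := by
    have h1 := k1 hT hTf (by omega)
    have e : σ (σ (σ α) + α) + (σ (σ α) + α) =
      (σ (σ (σ α) + α) - (σ (σ α) + α)) + 2 * (σ (σ α) + α) := by ring
    rw [e]
    have := h1.add hv_mul hv_add (y := 2 * (σ (σ α) + α))
      (by
        rcases htwo hT with h | h
        · exact Or.inl h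
        · right; rw [h]; omega)
    exact ⟨this.1, by rw [this.2]; omega⟩
  obtain ⟨S, hS⟩ : ∃ S, S = σ (σ (σ α) + α) + (σ (σ α) + α) := ⟨_, rfl⟩
  rw [← hS] at hTr
  have hSf : σ S = S := by rw [hS, map_add, hTf, add_comm]
  obtain ⟨r, hr⟩ : ∃ r, r = 2 * c₀ / S := ⟨_, rfl⟩
  have hrv : HasVal v r (4 * (e₀ - b₁)) := by
    have := (hv2.mul hv_mul hc).div hv_mul hTr
    rw [← hr] at this
    exact ⟨this.1, by rw [this.2]; ring⟩
  have hrf : σ r = r := by rw [hr, map_div₀, map_mul, hSf, hcf, hσ2]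
  have hrS : r * S = 2 * c₀ := by
    have := hTr.1
    rw [hr]; field_simp
  have hd : 0 < e₀ - b₁ := by omega
  -- scaling factors in `K₀`
  obtain ⟨k, hkv, hkf, hkr⟩ : ∃ k : ℤ → K, (∀ m, HasVal v (k m) (4 * m)) ∧
      (∀ m, σ (k m) = k m) ∧ ∀ m, k (m + e₀ - b₁) = r * k m := by
    choose t ht0 htf htv using hfix_onto
    have hrz : ∀ q : ℤ, HasVal v (r ^ q) (q * (4 * (e₀ - b₁))) := fun q => by
      induction q using Int.induction_on with
      | zero => simpa using hasVal_one hv_mul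
      | succ i ih =>
        rw [zpow_add_one₀ hrv.1]
        have := ih.mul hv_mul hrv
        exact ⟨this.1, by rw [this.2]; ring⟩
      | pred i ih =>
        rw [zpow_sub_one₀ hrv.1]
        have := ih.mul hv_mul (hrv.inv hv_mul)
        exact ⟨this.1, by rw [this.2]; ring⟩
    refine ⟨fun m => r ^ (m / (e₀ - b₁)) * t (m % (e₀ - b₁)), fun m => ?_, fun m => ?_, fun m => ?_⟩
    · have := (hrz (m / (e₀ - b₁))).mul hv_mul ⟨ht0 (m % (e₀ - b₁)), htv (m % (e₀ - b₁))⟩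
      refine ⟨this.1, ?_⟩
      rw [this.2]
      have := Int.mul_ediv_add_emod m (e₀ - b₁)
      linear_combination 4 * this
    · simp only [map_mul, map_zpow₀, hrf, htf]
    · have e : m + e₀ - b₁ = m + (e₀ - b₁) := by ring
      simp only [e, Int.add_emod_right]
      rw [Int.add_ediv_of_dvd_right (dvd_refl _), Int.ediv_self hd.ne', zpow_add_one₀ hrv.1]
      ring
  refine ⟨fun m => k m * α, fun m => ?_, fun m => ?_⟩
  · have := (hkv m).mul hv_mul hα
    exact ⟨this.1, by rw [this.2]; ring⟩
  · have key : (σ (k m * α) + k m * α) -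
            (2 : K)⁻¹ * (σ ((σ ^ 2) (k m * α) + k m * α) + ((σ ^ 2) (k m * α) + k m * α)) +
            (2 : K)⁻¹ * (σ ((σ ^ 2) (k (m + e₀ - b₁) * α) + k (m + e₀ - b₁) * α) +
              ((σ ^ 2) (k (m + e₀ - b₁) * α) + k (m + e₀ - b₁) * α)) = k m * ρ := by
      have h1 := congrArg σ hαβ
      rw [map_sub, map_sub] at h1
      rw [map_add] at hS
      simp only [hs2, map_mul, map_add, hkf, hkr, hrf]
      field_simp
      linear_combination k m * (hrS - r * hS - h1 - hαβ - hρt)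
    have h := (hkv m).mul hv_mul hρ
    rw [← key] at h
    exact ⟨h.1, by rw [h.2]; omega⟩
end
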